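/- arXiv:2410.08513 — 7 statements merged into one kernel-verified Lean document; each statement's English description precedes it below -/
import Mathlib

section
/- Fix an integer k ≥ 2 and reals α, β ∈ (0,1) with α + β ≥ (k+2)/k. Then there exists N such that for every integer n ≥ N and every integer ℓ ≥ 2 with 3k²ℓ ≤ n, one can find ⌊C(n,k)/ℓ⌋ (k,ℓ)-parpartitions of [n] such that (1) no k-element subset of [n] appears in two of these parpartitions, and (2) no two distinct parpartitions among them are (α,β)-close. -/
/-- A `(k, ℓ)`-parpartition of `[n] = {1, …, n}`: a family of `ℓ` pairwise disjoint
`k`-element subsets of `[n]`. -/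
def IsParpartition (n k ℓ : ℕ) (P : Finset (Finset ℕ)) : Prop :=
  P.card = ℓ ∧ (∀ A ∈ P, A ⊆ Finset.Icc 1 n ∧ A.card = k) ∧
    ∀ A ∈ P, ∀ B ∈ P, A ≠ B → Disjoint A B

/-- Two parpartitions `P₁` and `P₂` are `(α, β)`-close if there exist
`A₁ ≠ B₁ ∈ P₁` and `A₂ ≠ B₂ ∈ P₂` with `|A₁ ∩ A₂| > αk` and `|B₁ ∩ B₂| > βk`. -/
def ABClose (α β : ℝ) (k : ℕ) (P₁ P₂ : Finset (Finset ℕ)) : Prop :=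
  ∃ A₁ ∈ P₁, ∃ B₁ ∈ P₁, ∃ A₂ ∈ P₂, ∃ B₂ ∈ P₂,
    A₁ ≠ B₁ ∧ A₂ ≠ B₂ ∧ α * k < ((A₁ ∩ A₂).card : ℝ) ∧ β * k < ((B₁ ∩ B₂).card : ℝ)

open Finset in
/-- The colour class of `v` under the colouring `f`. -/
noncomputable def colourClass {V : Type*} [Fintype V] (f : V → ℕ) (v : V) : Finset V :=
  open Classical in univ.filter fun w => f w = f v

open Finset in
/-- The set of all `w` with `R v w`. -/
noncomputable def relNbrs {V : Type*} [Fintype V] (R : V → V → Prop) (v : V) : Finset V :=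
  open Classical in univ.filter fun w => R v w

@[simp] theorem mem_colourClass {V : Type*} [Fintype V] {f : V → ℕ} {v w : V} :
    w ∈ colourClass f v ↔ f w = f v := by simp [colourClass]

@[simp] theorem mem_relNbrs {V : Type*} [Fintype V] {R : V → V → Prop} {v w : V} :
    w ∈ relNbrs R v ↔ R v w := by simp [relNbrs]

/-- No two distinct `I`-related vertices have the same colour. -/
def ProperFor {V : Type*} (I : V → V → Prop) (f : V → ℕ) : Prop :=
  ∀ x y, I x y → f x ≠ f y

/-- Two pairs, each monochromatic, whose first entries are `R`-related and whose second entries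
are `S`-related. -/
def BadQuad {V : Type*} (R S : V → V → Prop) (f : V → ℕ) (x₁ y₁ x₂ y₂ : V) : Prop :=
  x₁ ≠ y₁ ∧ x₂ ≠ y₂ ∧ f x₁ = f y₁ ∧ f x₂ = f y₂ ∧ R x₁ x₂ ∧ S y₁ y₂

theorem BadQuad.symm {V : Type*} {R S : V → V → Prop} {f : V → ℕ} {x₁ y₁ x₂ y₂ : V}
    (hR : ∀ x y, R x y → R y x) (hS : ∀ x y, S x y → S y x)
    (h : BadQuad R S f x₁ y₁ x₂ y₂) : BadQuad R S f x₂ y₂ x₁ y₁ :=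
  ⟨h.2.1, h.1, h.2.2.2.1, h.2.2.1, hR _ _ h.2.2.2.2.1, hS _ _ h.2.2.2.2.2⟩

theorem BadQuad.flip {V : Type*} {R S : V → V → Prop} {f : V → ℕ} {x₁ y₁ x₂ y₂ : V}
    (h : BadQuad R S f x₁ y₁ x₂ y₂) : BadQuad S R f y₁ x₁ y₂ x₂ :=
  ⟨h.1.symm, h.2.1.symm, h.2.2.1.symm, h.2.2.2.1.symm, h.2.2.2.2.2, h.2.2.2.2.1⟩

/-- Exchanging the colours of `x` and `c` creates no monochromatic `I`-pair through `x` or `c`. -/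
structure SwapAdmissible {V : Type*} (I : V → V → Prop) (f : V → ℕ) (x c : V) : Prop where
  colour_ne : f c ≠ f x
  left : ∀ y, f y = f x → ¬ I y c
  right : ∀ y, I x y → f c ≠ f y

section Swap

variable {V : Type*} [DecidableEq V] {I : V → V → Prop} {f : V → ℕ} {x c : V}

theorem swap_colour_of_ne (f : V → ℕ) {x c y : V} (hx : y ≠ x) (hc : y ≠ c) : f (Equiv.swap x c y) = f y := by
  rw [Equiv.swap_apply_of_ne_of_ne hx hc]

theorem SwapAdmissible.swap_colour_ne_of_rel (h : SwapAdmissible I f x c)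
    (hI : ∀ y z, I y z → I z y) (irr : ∀ y, ¬ I y y) {y z : V} (hyz : I y z)
    (hy : y = x ∨ y = c) : f (Equiv.swap x c y) ≠ f (Equiv.swap x c z) := by
  have hne : c ≠ x := fun e => h.colour_ne (by rw [e])
  rcases hy with rfl | rfl
  · have hz : z ≠ y := fun e => irr _ (e ▸ hyz)
    have hzc : z ≠ c := fun e => h.left y rfl (e ▸ hyz)
    rw [Equiv.swap_apply_left, swap_colour_of_ne f hz hzc]
    exact h.right z hyz
  · have hz : z ≠ y := fun e => irr _ (e ▸ hyz)
    have hzx : z ≠ x := fun e => h.left x rfl (hI _ _ (e ▸ hyz))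
    rw [Equiv.swap_apply_right, swap_colour_of_ne f hzx hz]
    exact fun e => h.left z e.symm (hI _ _ hyz)

theorem SwapAdmissible.rel_of_swap_colour_eq (h : SwapAdmissible I f x c)
    (hI : ∀ y z, I y z → I z y) (irr : ∀ y, ¬ I y y) {y z : V} (hyz : I y z)
    (e : f (Equiv.swap x c y) = f (Equiv.swap x c z)) :
    (y ≠ x ∧ y ≠ c) ∧ z ≠ x ∧ z ≠ c := by
  refine ⟨⟨?_, ?_⟩, ?_, ?_⟩ <;> intro hy
  · exact h.swap_colour_ne_of_rel hI irr hyz (Or.inl hy) e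
  · exact h.swap_colour_ne_of_rel hI irr hyz (Or.inr hy) e
  · exact h.swap_colour_ne_of_rel hI irr (hI _ _ hyz) (Or.inl hy) e.symm
  · exact h.swap_colour_ne_of_rel hI irr (hI _ _ hyz) (Or.inr hy) e.symm

theorem SwapAdmissible.colour_eq_of_swap_colour_eq (h : SwapAdmissible I f x c)
    (hI : ∀ y z, I y z → I z y) (irr : ∀ y, ¬ I y y) {y z : V} (hyz : I y z)
    (e : f (Equiv.swap x c y) = f (Equiv.swap x c z)) : f y = f z := by
  obtain ⟨⟨h1, h2⟩, h3, h4⟩ := h.rel_of_swap_colour_eq hI irr hyz e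
  rwa [swap_colour_of_ne f h1 h2, swap_colour_of_ne f h3 h4] at e

/-- Exchanging the colours of `x` and `c` creates no bad quadruple with first entry in `{x, c}`. -/
structure SwapSafe (R S : V → V → Prop) (f : V → ℕ) (x c : V) : Prop where
  left : ∀ y₁ y₂ x₂, f y₁ = f x → S y₁ y₂ → f x₂ = f y₂ → ¬ R x₂ c
  right : ∀ x₂ y₂ y₁, R x x₂ → f y₂ = f x₂ → S y₂ y₁ → f c ≠ f y₁

theorem SwapAdmissible.not_badQuad {R S : V → V → Prop} (h : SwapAdmissible I f x c)
    (hI : ∀ y z, I y z → I z y) (irr : ∀ y, ¬ I y y) (hf : ProperFor I f)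
    (hRI : ∀ y z, R y z → I y z) (hSI : ∀ y z, S y z → I y z)
    (hR : ∀ y z, R y z → R z y) (hS : ∀ y z, S y z → S z y)
    (hs : SwapSafe R S f x c) {x₁ y₁ x₂ y₂ : V} (hx : x₁ = x ∨ x₁ = c) :
    ¬ BadQuad R S (f ∘ Equiv.swap x c) x₁ y₁ x₂ y₂ := by
  rintro ⟨n₁, n₂, e₁, e₂, r, s⟩
  simp only [Function.comp] at e₁ e₂
  have hne : f c ≠ f x := h.colour_ne
  have hxc : ¬ I x c := h.left x rfl
  rcases hx with rfl | rfl
  · rw [Equiv.swap_apply_left] at e₁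
    have hy₁c : y₁ ≠ c := by
      rintro rfl
      rw [Equiv.swap_apply_right] at e₁
      exact hne e₁
    rw [swap_colour_of_ne f n₁.symm hy₁c] at e₁
    have h1 : x₂ ≠ x₁ := fun e => irr _ (e ▸ hRI _ _ r)
    have h2 : x₂ ≠ c := fun e => hxc (e ▸ hRI _ _ r)
    have h3 : y₂ ≠ c := fun e => hf _ _ (e ▸ hSI _ _ s) e₁.symm
    have h4 : y₂ ≠ x₁ := fun e => h.right y₁ (hI _ _ (e ▸ hSI _ _ s)) e₁
    rw [swap_colour_of_ne f h1 h2, swap_colour_of_ne f h4 h3] at e₂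
    exact hs.right x₂ y₂ y₁ r e₂.symm (hS _ _ s) e₁
  · rw [Equiv.swap_apply_right] at e₁
    have hy₁x : y₁ ≠ x := by
      rintro rfl
      rw [Equiv.swap_apply_left] at e₁
      exact hne e₁.symm
    rw [swap_colour_of_ne f hy₁x n₁.symm] at e₁
    have h1 : x₂ ≠ x₁ := fun e => irr _ (e ▸ hRI _ _ r)
    have h2 : x₂ ≠ x := fun e => hxc (hI _ _ (e ▸ hRI _ _ r))
    have h3 : y₂ ≠ x := fun e => hf _ _ (e ▸ hSI _ _ s) e₁.symm
    have h4 : y₂ ≠ x₁ := fun e => h.left y₁ e₁.symm (e ▸ hSI _ _ s)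
    rw [swap_colour_of_ne f h2 h1, swap_colour_of_ne f h3 h4] at e₂
    exact hs.left y₁ y₂ x₂ e₁.symm s e₂ (hR _ _ r)

end Swap

theorem card_colourClass_comp_perm_le {V : Type*} [Fintype V] {ℓ : ℕ} (f : V → ℕ)
    (hcls : ∀ v, (colourClass f v).card ≤ ℓ)
    (σ : Equiv.Perm V) (v : V) : (colourClass (f ∘ σ) v).card ≤ ℓ := by
  refine le_trans (Finset.card_le_card_of_injOn σ ?_ σ.injective.injOn) (hcls (σ v))
  intro w hw
  simpa using hw

section Recolouring

variable {V : Type*} [Fintype V] [DecidableEq V] {I R S : V → V → Prop} {ℓ Δ a b : ℕ}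

open Finset in
/-- If colour classes and degrees are small, then some `c` may exchange its colour with `x`. -/
theorem exists_swapAdmissible_swapSafe (f : V → ℕ) (x : V)
    (hcls : ∀ v, (colourClass f v).card ≤ ℓ) (hΔ : ∀ v, (relNbrs I v).card ≤ Δ)
    (ha : ∀ v, (relNbrs R v).card ≤ a) (hb : ∀ v, (relNbrs S v).card ≤ b)
    (hcard : ℓ + 2 * (ℓ * Δ) + 4 * (ℓ * ℓ * (a * b)) < Fintype.card V) :
    ∃ c, SwapAdmissible I f x c ∧ SwapSafe R S f x c ∧ SwapSafe S R f x c := by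
  let T : (V → V → Prop) → (V → V → Prop) → Finset V := fun R S =>
    (colourClass f x).biUnion fun y₁ => (relNbrs S y₁).biUnion fun y₂ =>
      (colourClass f y₂).biUnion fun x₂ => relNbrs R x₂
  let U : (V → V → Prop) → (V → V → Prop) → Finset V := fun R S =>
    (relNbrs R x).biUnion fun x₂ => (colourClass f x₂).biUnion fun y₂ =>
      (relNbrs S y₂).biUnion fun y₁ => colourClass f y₁
  have bound {s : Finset V} {t : V → Finset V} {p q : ℕ} (hs : s.card ≤ p)
      (ht : ∀ v, (t v).card ≤ q) : (s.biUnion t).card ≤ p * q :=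
    (card_biUnion_le_card_mul _ _ _ fun v _ => ht v).trans (Nat.mul_le_mul_right _ hs)
  have hT {R S : V → V → Prop} {a b : ℕ} (ha : ∀ v, (relNbrs R v).card ≤ a)
      (hb : ∀ v, (relNbrs S v).card ≤ b) : (T R S).card ≤ ℓ * (b * (ℓ * a)) :=
    bound (hcls _) fun _ => bound (hb _) fun _ => bound (hcls _) ha
  have hU {R S : V → V → Prop} {a b : ℕ} (ha : ∀ v, (relNbrs R v).card ≤ a)
      (hb : ∀ v, (relNbrs S v).card ≤ b) : (U R S).card ≤ a * (ℓ * (b * ℓ)) :=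
    bound (ha _) fun _ => bound (hcls _) fun _ => bound (hb _) hcls
  let E : Finset V := colourClass f x ∪ (colourClass f x).biUnion (relNbrs I) ∪
    (relNbrs I x).biUnion (colourClass f) ∪ T R S ∪ T S R ∪ U R S ∪ U S R
  have hE : E.card < Fintype.card V := by
    have h1 := hcls x
    have h2 := bound (hcls x) hΔ
    have h3 := bound (hΔ x) hcls
    have h4 := hT ha hb
    have h5 := hT hb ha
    have h6 := hU ha hb
    have h7 := hU hb ha
    refine lt_of_le_of_lt ?_ hcard
    refine (card_union_le _ _).trans ((add_le_add ((card_union_le _ _).trans (add_le_add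
      ((card_union_le _ _).trans (add_le_add ((card_union_le _ _).trans (add_le_add
      ((card_union_le _ _).trans (add_le_add ((card_union_le _ _).trans
      (add_le_add h1 h2)) h3)) h4)) h5)) h6)) h7).trans (le_of_eq ?_))
    ring
  obtain ⟨c, hc⟩ : ∃ c, c ∉ E := by
    by_contra! hall
    exact hE.ne ((card_eq_iff_eq_univ _).2 (eq_univ_of_forall hall))
  simp only [E, T, U, mem_union, mem_biUnion, mem_colourClass, mem_relNbrs, not_or, not_exists,
    not_and] at hc
  obtain ⟨⟨⟨⟨⟨⟨h1, h2⟩, h3⟩, h4⟩, h5⟩, h6⟩, h7⟩ := hc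
  exact ⟨c, ⟨h1, h2, h3⟩, ⟨fun y₁ y₂ x₂ p q r => h4 y₁ p y₂ q x₂ r,
    fun x₂ y₂ y₁ p q r => h6 x₂ p y₂ q y₁ r⟩, ⟨fun y₁ y₂ x₂ p q r => h5 y₁ p y₂ q x₂ r,
    fun x₂ y₂ y₁ p q r => h7 x₂ p y₂ q y₁ r⟩⟩

open Finset in
theorem exists_perm_properFor (f : V → ℕ) (hI : ∀ y z, I y z → I z y) (irr : ∀ y, ¬ I y y)
    (hcls : ∀ v, (colourClass f v).card ≤ ℓ) (hΔ : ∀ v, (relNbrs I v).card ≤ Δ)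
    (hcard : ℓ + 2 * (ℓ * Δ) < Fintype.card V) :
    ∃ σ : Equiv.Perm V, ProperFor I (f ∘ σ) := by
  classical
  let M : Equiv.Perm V → Finset (V × V) := fun σ =>
    univ.filter fun p => I p.1 p.2 ∧ f (σ p.1) = f (σ p.2)
  have hM (σ : Equiv.Perm V) (p : V × V) :
      p ∈ M σ ↔ I p.1 p.2 ∧ f (σ p.1) = f (σ p.2) := by simp [M]
  obtain ⟨σ, hσ⟩ := Finite.exists_min fun σ => (M σ).card
  refine ⟨σ, fun x y hxy e => ?_⟩
  obtain ⟨c, hc, -, -⟩ := exists_swapAdmissible_swapSafe (I := I) (R := fun _ _ => False)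
    (S := fun _ _ => False) (a := 0) (b := 0) (f ∘ σ) x
    (card_colourClass_comp_perm_le f hcls σ) hΔ (by simp [relNbrs]) (by simp [relNbrs])
    (by simpa using hcard)
  refine (card_lt_card ?_).not_ge (hσ ((Equiv.swap x c).trans σ))
  refine (ssubset_iff_of_subset ?_).2 ⟨(x, y), (hM _ _).2 ⟨hxy, e⟩, ?_⟩
  · rintro ⟨y, z⟩ h
    rw [hM] at h ⊢
    exact ⟨h.1, hc.colour_eq_of_swap_colour_eq hI irr h.1 h.2⟩
  · intro h
    rw [hM] at h
    exact hc.swap_colour_ne_of_rel hI irr hxy (Or.inl rfl) h.2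

open Finset in
/-- A colouring with small classes can be permuted into one that is proper for `I` and has no
bad quadruple. -/
theorem exists_perm_properFor_not_badQuad (f : V → ℕ)
    (hI : ∀ y z, I y z → I z y) (irr : ∀ y, ¬ I y y)
    (hRI : ∀ y z, R y z → I y z) (hSI : ∀ y z, S y z → I y z)
    (hR : ∀ y z, R y z → R z y) (hS : ∀ y z, S y z → S z y)
    (hcls : ∀ v, (colourClass f v).card ≤ ℓ) (hΔ : ∀ v, (relNbrs I v).card ≤ Δ)
    (ha : ∀ v, (relNbrs R v).card ≤ a) (hb : ∀ v, (relNbrs S v).card ≤ b)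
    (hcard : ℓ + 2 * (ℓ * Δ) + 4 * (ℓ * ℓ * (a * b)) < Fintype.card V) :
    ∃ σ : Equiv.Perm V, ProperFor I (f ∘ σ) ∧
      ∀ x₁ y₁ x₂ y₂, ¬ BadQuad R S (f ∘ σ) x₁ y₁ x₂ y₂ := by
  classical
  let M : Equiv.Perm V → Finset (V × V × V × V) := fun σ =>
    univ.filter fun p => BadQuad R S (f ∘ σ) p.1 p.2.1 p.2.2.1 p.2.2.2
  obtain ⟨τ, hτ⟩ := exists_perm_properFor f hI irr hcls hΔ ((Nat.le_add_right _ _).trans_lt hcard)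
  obtain ⟨σ, hσ, hmin⟩ := exists_min_image (univ.filter fun σ : Equiv.Perm V =>
    ProperFor I (f ∘ σ)) (fun σ => (M σ).card) ⟨τ, by simpa using hτ⟩
  simp only [mem_filter_univ] at hσ hmin
  refine ⟨σ, hσ, fun x y x' y' hbad => ?_⟩
  obtain ⟨c, hc, hs, hs'⟩ := exists_swapAdmissible_swapSafe (f ∘ σ) x
    (card_colourClass_comp_perm_le f hcls σ) hΔ ha hb hcard
  have hproper : ProperFor I (f ∘ ((Equiv.swap x c).trans σ)) := fun y z hyz e =>
    hσ y z hyz (hc.colour_eq_of_swap_colour_eq hI irr hyz e)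
  have hno {x₁ y₁ x₂ y₂ : V} (hx : x₁ = x ∨ x₁ = c) :
      ¬ BadQuad R S (f ∘ ((Equiv.swap x c).trans σ)) x₁ y₁ x₂ y₂ :=
    hc.not_badQuad hI irr hσ hRI hSI hR hS hs hx
  have hno' {x₁ y₁ x₂ y₂ : V} (hx : x₁ = x ∨ x₁ = c) :
      ¬ BadQuad S R (f ∘ ((Equiv.swap x c).trans σ)) x₁ y₁ x₂ y₂ :=
    hc.not_badQuad hI irr hσ hSI hRI hS hR hs' hx
  refine (card_lt_card ?_).not_ge (hmin _ hproper)
  refine (ssubset_iff_of_subset ?_).2 ⟨(x, y, x', y'), by simpa [M] using hbad, ?_⟩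
  · rintro ⟨x₁, y₁, x₂, y₂⟩ h
    simp only [M, mem_filter_univ] at h ⊢
    have k1 : x₁ ≠ x ∧ x₁ ≠ c := not_or.1 fun hx => hno hx h
    have k2 : x₂ ≠ x ∧ x₂ ≠ c := not_or.1 fun hx => hno hx (h.symm hR hS)
    have k3 : y₁ ≠ x ∧ y₁ ≠ c := not_or.1 fun hx => hno' hx h.flip
    have k4 : y₂ ≠ x ∧ y₂ ≠ c := not_or.1 fun hx => hno' hx (h.symm hR hS).flip
    obtain ⟨n₁, n₂, e₁, e₂, r, s⟩ := h
    simp only [Function.comp, Equiv.trans_apply] at e₁ e₂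
    rw [Equiv.swap_apply_of_ne_of_ne k1.1 k1.2, Equiv.swap_apply_of_ne_of_ne k3.1 k3.2] at e₁
    rw [Equiv.swap_apply_of_ne_of_ne k2.1 k2.2, Equiv.swap_apply_of_ne_of_ne k4.1 k4.2] at e₂
    exact ⟨n₁, n₂, e₁, e₂, r, s⟩
  · intro h
    simp only [M, mem_filter_univ] at h
    exact hno (Or.inl rfl) h

end Recolouring

open Finset in
theorem card_filter_superset_powersetCard_le {α : Type*} [DecidableEq α] {S T : Finset α}
    (hT : T ⊆ S) (k : ℕ) :
    ((powersetCard k S).filter (T ⊆ ·)).card ≤ (S.card - T.card).choose (k - T.card) := by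
  rw [← card_sdiff_of_subset hT, ← card_powersetCard]
  refine card_le_card_of_injOn (· \ T) ?_ ?_
  · intro B hB
    simp only [mem_coe, mem_filter, mem_powersetCard] at hB ⊢
    exact ⟨sdiff_subset_sdiff hB.1.1 le_rfl, by rw [card_sdiff_of_subset hB.2, hB.1.2]⟩
  · intro B hB C hC h
    simp only [mem_coe, mem_filter, mem_powersetCard] at hB hC
    simp only at h
    rw [← sdiff_union_of_subset hB.2, h, sdiff_union_of_subset hC.2]

open Finset in
theorem card_filter_le_card_inter_le {α : Type*} [DecidableEq α] {S A : Finset α}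
    (hA : A ⊆ S) (k a : ℕ) :
    ((powersetCard k S).filter fun B => a ≤ (A ∩ B).card).card ≤
      A.card.choose a * (S.card - a).choose (k - a) := by
  rw [← card_powersetCard a A]
  refine le_trans (card_le_card ?_) (card_biUnion_le_card_mul (powersetCard a A)
    (fun T => (powersetCard k S).filter (T ⊆ ·)) _ ?_)
  · intro B hB
    rw [mem_filter] at hB
    obtain ⟨T, hT, hTc⟩ := exists_subset_card_eq hB.2
    exact mem_biUnion.2 ⟨T, mem_powersetCard.2 ⟨hT.trans inter_subset_left, hTc⟩,
      mem_filter.2 ⟨hB.1, hT.trans inter_subset_right⟩⟩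
  · intro T hT
    obtain ⟨hTA, rfl⟩ := mem_powersetCard.1 hT
    exact card_filter_superset_powersetCard_le (hTA.trans hA) k

open Finset in
theorem card_relNbrs_subtype_le {n k a : ℕ} {R : powersetCard k (Icc 1 n) →
    powersetCard k (Icc 1 n) → Prop} (hR : ∀ A B, R A B → a ≤ (A.1 ∩ B.1).card)
    (A : powersetCard k (Icc 1 n)) :
    (relNbrs R A).card ≤ k.choose a * (n - a).choose (k - a) := by
  have hA := mem_powersetCard.1 A.2
  have h := card_filter_le_card_inter_le hA.1 k a
  rw [hA.2, Nat.card_Icc, Nat.add_sub_cancel] at h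
  refine le_trans (card_le_card_of_injOn Subtype.val ?_ Subtype.val_injective.injOn) h
  intro B hB
  simp only [mem_coe, mem_relNbrs] at hB
  exact mem_filter.2 ⟨B.2, hR A B hB⟩

theorem three_mul_choose_pred_le {n k ℓ : ℕ} (hk : 1 ≤ k) (hℓ : 1 ≤ ℓ)
    (h : 3 * k ^ 2 * ℓ ≤ n) : 3 * (ℓ * (k * (n - 1).choose (k - 1))) ≤ n.choose k := by
  have hn : 1 ≤ n := le_trans (by nlinarith [Nat.one_le_pow 2 k hk]) h
  obtain ⟨m, rfl⟩ := Nat.exists_eq_add_of_le' hn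
  obtain ⟨j, rfl⟩ := Nat.exists_eq_add_of_le' hk
  have e := Nat.add_one_mul_choose_eq m j
  simp only [Nat.add_sub_cancel]
  refine Nat.le_of_mul_le_mul_left (c := j + 1) ?_ (by omega)
  calc (j + 1) * (3 * (ℓ * ((j + 1) * m.choose j)))
      = (3 * (j + 1) ^ 2 * ℓ) * m.choose j := by ring
    _ ≤ (m + 1) * m.choose j := Nat.mul_le_mul_right _ h
    _ = (j + 1) * (m + 1).choose (j + 1) := by rw [e]; ring

open scoped Nat in
theorem pow_le_pow_self_mul_factorial_mul_choose {n k : ℕ} (h : k ≤ n) :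
    n ^ k ≤ k ^ k * k ! * n.choose k := by
  rcases Nat.eq_zero_or_pos k with rfl | hk
  · simp
  have hle : n ≤ k * (n + 1 - k) := by
    obtain ⟨m, rfl⟩ := Nat.exists_eq_add_of_le h
    rw [show k + m + 1 - k = m + 1 by omega]
    nlinarith
  calc n ^ k ≤ (k * (n + 1 - k)) ^ k := Nat.pow_le_pow_left hle k
    _ = k ^ k * (n + 1 - k) ^ k := mul_pow ..
    _ ≤ k ^ k * n.descFactorial k := Nat.mul_le_mul_left _ (n.pow_sub_le_descFactorial k)
    _ = k ^ k * k ! * n.choose k := by rw [n.descFactorial_eq_factorial_mul_choose, mul_assoc]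

open scoped Nat in
theorem lower_order_lt_choose {n k ℓ a b : ℕ} (hn : 3 * (4 ^ (k + 1) + 1) * (k ^ k * k !) < n)
    (hk : 3 ≤ k) (hℓ : ℓ ≤ n) (ha : a ≤ k) (hb : b ≤ k) (hab : k + 3 ≤ a + b) :
    3 * (ℓ + 4 * (ℓ * ℓ * ((k.choose a * (n - a).choose (k - a)) *
      (k.choose b * (n - b).choose (k - b))))) < n.choose k := by
  have hn0 : 1 ≤ n := by omega
  have hkn : k ≤ n := by
    calc k ≤ k ^ k * k ! := (Nat.le_self_pow (by omega) k).trans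
          (Nat.le_mul_of_pos_right _ k.factorial_pos)
      _ ≤ 3 * (4 ^ (k + 1) + 1) * (k ^ k * k !) := Nat.le_mul_of_pos_left _ (by positivity)
      _ ≤ n := hn.le
  have hdeg (c : ℕ) : k.choose c * (n - c).choose (k - c) ≤ 2 ^ k * n ^ (k - c) :=
    Nat.mul_le_mul (Nat.choose_le_two_pow _ _) ((Nat.choose_le_pow _ _).trans
      (Nat.pow_le_pow_left (Nat.sub_le _ _) _))
  have hprod : ℓ + 4 * (ℓ * ℓ * ((k.choose a * (n - a).choose (k - a)) *
      (k.choose b * (n - b).choose (k - b)))) ≤ (4 ^ (k + 1) + 1) * n ^ (k - 1) := by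
    calc _ ≤ n ^ (k - 1) + 4 * (n * n * ((2 ^ k * n ^ (k - a)) * (2 ^ k * n ^ (k - b)))) := by
          refine add_le_add (hℓ.trans (Nat.le_self_pow (by omega) n)) ?_
          exact Nat.mul_le_mul_left _ (Nat.mul_le_mul (Nat.mul_le_mul hℓ hℓ)
            (Nat.mul_le_mul (hdeg a) (hdeg b)))
      _ = n ^ (k - 1) + 4 ^ (k + 1) * n ^ (2 + (k - a) + (k - b)) := by
          rw [show (4 : ℕ) ^ (k + 1) = 4 * (2 ^ k * 2 ^ k) by
            rw [← mul_pow]; norm_num; ring]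
          ring
      _ ≤ n ^ (k - 1) + 4 ^ (k + 1) * n ^ (k - 1) := by
          gcongr
          omega
      _ = _ := by ring
  refine Nat.lt_of_mul_lt_mul_left (a := k ^ k * k !) ?_
  calc _ ≤ k ^ k * k ! * (3 * ((4 ^ (k + 1) + 1) * n ^ (k - 1))) := by gcongr
    _ = (3 * (4 ^ (k + 1) + 1) * (k ^ k * k !)) * n ^ (k - 1) := by ring
    _ < n * n ^ (k - 1) := Nat.mul_lt_mul_of_pos_right hn (Nat.pow_pos hn0)
    _ = n ^ k := by rw [← pow_succ', Nat.sub_add_cancel (by omega)]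
    _ ≤ _ := pow_le_pow_self_mul_factorial_mul_choose hkn

open Finset in
/-- Every finite type can be coloured so that each of the colours below `|V| / ℓ` is used exactly
`ℓ` times, and no colour is used more often. -/
theorem exists_equitable_colouring (V : Type*) [Fintype V] {ℓ : ℕ} (hℓ : 0 < ℓ) :
    ∃ f : V → ℕ, (∀ c, (univ.filter fun v => f v = c).card ≤ ℓ) ∧
      ∀ c < Fintype.card V / ℓ, (univ.filter fun v => f v = c).card = ℓ := by
  let e := Fintype.equivFin V
  have key (c : ℕ) : (univ.filter fun v => (e v : ℕ) / ℓ = c).card =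
      ((range (Fintype.card V)).filter fun i => i / ℓ = c).card := by
    refine card_bij (fun v _ => (e v : ℕ)) (by simp) ?_ ?_
    · intro v _ w _ h
      exact e.injective (Fin.ext h)
    · intro i hi
      rw [mem_filter, mem_range] at hi
      exact ⟨e.symm ⟨i, hi.1⟩, by simpa using hi.2, by simp⟩
  have hdiv (i c : ℕ) : i / ℓ = c ↔ i ∈ Ico (c * ℓ) (c * ℓ + ℓ) := by
    rw [Nat.div_eq_iff hℓ, mem_Ico]; omega
  refine ⟨fun v => (e v : ℕ) / ℓ, fun c => ?_, fun c hc => ?_⟩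
  · rw [key]
    refine (card_le_card (t := Ico (c * ℓ) (c * ℓ + ℓ)) fun i hi => ?_).trans (by simp)
    exact (hdiv i c).1 (mem_filter.1 hi).2
  · rw [key]
    have : ((range (Fintype.card V)).filter fun i => i / ℓ = c) = Ico (c * ℓ) (c * ℓ + ℓ) := by
      ext i
      rw [mem_filter, mem_range, hdiv, and_iff_right_iff_imp, mem_Ico]
      intro h
      have := (Nat.le_div_iff_mul_le hℓ).1 (Nat.succ_le_of_lt hc)
      rw [Nat.succ_mul] at this
      omega
    simp [this]

open Finset in
/-- A suitable colouring of the `k`-subsets yields the family of parpartitions. -/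
theorem exists_family_of_colouring {n k ℓ m : ℕ} {α β : ℝ} (hℓ : 2 ≤ ℓ)
    (f : powersetCard k (Icc 1 n) → ℕ)
    (hcls : ∀ c < m, (univ.filter fun A => f A = c).card = ℓ)
    (hproper : ∀ A B, A ≠ B → f A = f B → Disjoint A.1 B.1)
    (hclose : ∀ A₁ B₁ A₂ B₂, A₁ ≠ B₁ → A₂ ≠ B₂ → f A₁ = f B₁ → f A₂ = f B₂ → f A₁ ≠ f A₂ →
      α * k < ((A₁.1 ∩ A₂.1).card : ℝ) → ¬ β * k < ((B₁.1 ∩ B₂.1).card : ℝ)) :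
    ∃ F : Finset (Finset (Finset ℕ)),
      F.card = m ∧
      (∀ P ∈ F, IsParpartition n k ℓ P) ∧
      (∀ P₁ ∈ F, ∀ P₂ ∈ F, P₁ ≠ P₂ → Disjoint P₁ P₂) ∧
      (∀ P₁ ∈ F, ∀ P₂ ∈ F, P₁ ≠ P₂ → ¬ ABClose α β k P₁ P₂) := by
  let P : ℕ → Finset (Finset ℕ) := fun c =>
    (univ.filter fun A => f A = c).map (Function.Embedding.subtype _)
  have memP {c : ℕ} {A : Finset ℕ} : A ∈ P c ↔ ∃ h : A ∈ powersetCard k (Icc 1 n),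
      f ⟨A, h⟩ = c := by
    simp [P]
  have hPdisj {c d : ℕ} (h : c ≠ d) : Disjoint (P c) (P d) := by
    rw [disjoint_left]
    intro A hc hd
    obtain ⟨h1, h2⟩ := memP.1 hc
    obtain ⟨h3, h4⟩ := memP.1 hd
    exact h (h2.symm.trans h4)
  have hPcard {c : ℕ} (h : c < m) : (P c).card = ℓ := by
    rw [card_map, hcls c h]
  refine ⟨(range m).image P, ?_, ?_, ?_, ?_⟩
  · rw [card_image_of_injOn, card_range]
    intro c hc d hd h
    by_contra hne
    have h0 := hPdisj hne
    rw [← h, disjoint_self_iff_empty] at h0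
    have h1 := hPcard (mem_range.1 hc)
    rw [h0, card_empty] at h1
    omega
  · intro Q hQ
    obtain ⟨c, hc, rfl⟩ := mem_image.1 hQ
    refine ⟨hPcard (mem_range.1 hc), ?_, ?_⟩
    · intro A hA
      exact mem_powersetCard.1 (memP.1 hA).1
    · intro A hA B hB hne
      obtain ⟨hA, hA'⟩ := memP.1 hA
      obtain ⟨hB, hB'⟩ := memP.1 hB
      exact hproper ⟨A, hA⟩ ⟨B, hB⟩ (by simpa using hne) (hA'.trans hB'.symm)
  · intro Q hQ Q' hQ' hne
    obtain ⟨c, hc, rfl⟩ := mem_image.1 hQ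
    obtain ⟨d, hd, rfl⟩ := mem_image.1 hQ'
    exact hPdisj fun h => hne (by rw [h])
  · rintro Q hQ Q' hQ' hne ⟨A₁, hA₁, B₁, hB₁, A₂, hA₂, B₂, hB₂, n₁, n₂, hα, hβ⟩
    obtain ⟨c, hc, rfl⟩ := mem_image.1 hQ
    obtain ⟨d, hd, rfl⟩ := mem_image.1 hQ'
    obtain ⟨hA₁, eA₁⟩ := memP.1 hA₁
    obtain ⟨hB₁, eB₁⟩ := memP.1 hB₁
    obtain ⟨hA₂, eA₂⟩ := memP.1 hA₂
    obtain ⟨hB₂, eB₂⟩ := memP.1 hB₂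
    refine hclose ⟨A₁, hA₁⟩ ⟨B₁, hB₁⟩ ⟨A₂, hA₂⟩ ⟨B₂, hB₂⟩ (by simpa using n₁) (by simpa using n₂)
      (eA₁.trans eB₁.symm) (eA₂.trans eB₂.symm) ?_ hα hβ
    rw [eA₁, eA₂]
    exact fun h => hne (by rw [h])

theorem stmt0 (k : ℕ) (hk : 2 ≤ k) (α β : ℝ) (hα : α ∈ Set.Ioo (0 : ℝ) 1)
    (hβ : β ∈ Set.Ioo (0 : ℝ) 1) (hαβ : ((k : ℝ) + 2) / k ≤ α + β) :
    ∃ N : ℕ, ∀ n : ℕ, N ≤ n → ∀ ℓ : ℕ, 2 ≤ ℓ → 3 * k ^ 2 * ℓ ≤ n →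
      ∃ F : Finset (Finset (Finset ℕ)),
        F.card = n.choose k / ℓ ∧
        (∀ P ∈ F, IsParpartition n k ℓ P) ∧
        (∀ P₁ ∈ F, ∀ P₂ ∈ F, P₁ ≠ P₂ → Disjoint P₁ P₂) ∧
        (∀ P₁ ∈ F, ∀ P₂ ∈ F, P₁ ≠ P₂ → ¬ ABClose α β k P₁ P₂) := by
  classical
  have hk0 : (0 : ℝ) < k := by positivity
  rw [div_le_iff₀ hk0, add_mul] at hαβ
  have hα0 : 0 ≤ α * k := mul_nonneg hα.1.le hk0.le
  have hβ0 : 0 ≤ β * k := mul_nonneg hβ.1.le hk0.le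
  have hα1 : α * k < k := by nlinarith [hα.2]
  have hβ1 : β * k < k := by nlinarith [hβ.2]
  set a := ⌊α * k⌋₊ + 1 with ha
  set b := ⌊β * k⌋₊ + 1 with hb
  have hak : a ≤ k := (Nat.floor_lt hα0).2 hα1
  have hbk : b ≤ k := (Nat.floor_lt hβ0).2 hβ1
  have hab : k + 3 ≤ a + b := by
    have h1 := Nat.lt_floor_add_one (α * k)
    have h2 := Nat.lt_floor_add_one (β * k)
    have h3 : ((k + 2 : ℕ) : ℝ) < ((a + b : ℕ) : ℝ) := by
      push_cast [ha, hb]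
      linarith
    exact Nat.cast_lt.1 h3
  refine ⟨3 * (4 ^ (k + 1) + 1) * (k ^ k * k.factorial) + 1, fun n hn ℓ hℓ hℓn => ?_⟩
  have hℓn' : ℓ ≤ n := le_trans (Nat.le_mul_of_pos_left _ (by positivity)) hℓn
  let V := Finset.powersetCard k (Finset.Icc 1 n)
  have hV : Fintype.card V = n.choose k := by simp [V]
  let I : V → V → Prop := fun A B => A ≠ B ∧ 1 ≤ (A.1 ∩ B.1).card
  let R : ℝ → V → V → Prop := fun γ A B => A ≠ B ∧ γ * k < ((A.1 ∩ B.1).card : ℝ)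
  have Rsymm (γ : ℝ) (A B : V) (h : R γ A B) : R γ B A :=
    ⟨h.1.symm, by rw [Finset.inter_comm]; exact h.2⟩
  have RI {γ : ℝ} (h0 : 0 ≤ γ * k) (A B : V) (h : R γ A B) : I A B :=
    ⟨h.1, by exact_mod_cast h0.trans_lt h.2⟩
  have Rdeg {γ : ℝ} (h0 : 0 ≤ γ * k) (A B : V) (h : R γ A B) :
      ⌊γ * k⌋₊ + 1 ≤ (A.1 ∩ B.1).card := (Nat.floor_lt h0).2 h.2
  obtain ⟨f, hf, hf'⟩ := exists_equitable_colouring V (show 0 < ℓ by omega)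
  have hΔ := three_mul_choose_pred_le (by omega) (by omega) hℓn
  have hlow := lower_order_lt_choose hn (by omega) hℓn' hak hbk hab
  obtain ⟨σ, hσ, hquad⟩ := exists_perm_properFor_not_badQuad (I := I) (R := R α) (S := R β)
    (ℓ := ℓ) f (fun A B h => ⟨h.1.symm, by rw [Finset.inter_comm]; exact h.2⟩)
    (fun A h => h.1 rfl) (RI hα0) (RI hβ0) (Rsymm α) (Rsymm β)
    (fun v => by simpa [colourClass] using hf (f v))
    (card_relNbrs_subtype_le fun A B h => h.2) (card_relNbrs_subtype_le (Rdeg hα0))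
    (card_relNbrs_subtype_le (Rdeg hβ0))
    (by rw [hV, Nat.choose_one_right]; rw [← ha, ← hb]; omega)
  refine exists_family_of_colouring hℓ (f ∘ σ) (fun c hc => ?_) (fun A B hne h => ?_) ?_
  · rw [← hf' c (by rwa [hV])]
    exact Finset.card_equiv σ (by simp)
  · by_contra hd
    refine hσ A B ⟨hne, ?_⟩ h
    rwa [Nat.one_le_iff_ne_zero, Finset.card_ne_zero, ← Finset.not_disjoint_iff_nonempty_inter]
  · intro A₁ B₁ A₂ B₂ n₁ n₂ e₁ e₂ hne h h'
    exact hquad A₁ B₁ A₂ B₂ ⟨n₁, n₂, e₁, e₂, ⟨fun e => hne (by rw [e]), h⟩,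
      ⟨fun e => hne (by rw [e₁, e₂, e]), h'⟩⟩
end

section
/- Let ℓ ≥ 2 be an integer and let G1 = (V,E1), G2 = (V,E2), G3 = (V,E3) be three simple graphs on the same vertex set V with |V| = m, such that E1 ∩ E2 = ∅ and E1 ∩ E3 = ∅. Let δ1 be the minimum degree of G1 and let Δ2, Δ3 be the maximum degrees of G2 and G3. If m(3ℓ−1)/(3ℓ) ≤ δ1 and Δ2·Δ3 ≤ (m−3)/(15ℓ²), then there exist ⌊m/ℓ⌋ pairwise vertex-disjoint ℓ-cliques in G1 such that no two of these cliques form an alternating-(ℓ,2,ℓ,2)-bag with G2 and G3. -/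
/-- Two (vertex-disjoint) `ℓ`-cliques `A₁` and `A₂` form an alternating-`(ℓ,2,ℓ,2)`-bag
with `G₂` and `G₃` if there are two vertex-disjoint edges, one of `G₂` and one of `G₃`,
each connecting a vertex of `A₁` to a vertex of `A₂`. -/
def AltBag {V : Type*} (G₂ G₃ : SimpleGraph V) (A₁ A₂ : Finset V) : Prop :=
  ∃ a b c d : V, a ∈ A₁ ∧ b ∈ A₂ ∧ c ∈ A₁ ∧ d ∈ A₂ ∧
    G₂.Adj a b ∧ G₃.Adj c d ∧ a ≠ c ∧ a ≠ d ∧ b ≠ c ∧ b ≠ d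

open Finset

namespace SimpleGraph

variable {V ι : Type*}

theorem exists_eq_empty_of_descent {α β : Type*} (P : α → Prop) (T : α → Finset β)
    (hstep : ∀ f, P f → (T f).Nonempty → ∃ g, P g ∧ T g ⊂ T f) {f : α} (hf : P f) :
    ∃ g, P g ∧ T g = ∅ := by
  induction hs : T f using Finset.strongInduction generalizing f with
  | H s ih =>
    subst hs
    rcases (T f).eq_empty_or_nonempty with h | h
    · exact ⟨f, hf, h⟩
    · obtain ⟨g, hg, hgf⟩ := hstep f hf h
      exact ih _ hgf hg rfl

/-- Disjoint edges `ab` of `G₂` and `cd` of `G₃` joining the same two colour classes of `f`. -/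
def ColorBag (G₂ G₃ : SimpleGraph V) (f : V → ι) (a b c d : V) : Prop :=
  G₂.Adj a b ∧ G₃.Adj c d ∧ f a = f c ∧ f b = f d ∧ f a ≠ f b ∧ a ≠ c ∧ b ≠ d

theorem ColorBag.flip {G₂ G₃ : SimpleGraph V} {f : V → ι} {a b c d : V}
    (h : ColorBag G₂ G₃ f a b c d) : ColorBag G₂ G₃ f b a d c :=
  let ⟨h₁, h₂, h₃, h₄, h₅, h₆, h₇⟩ := h
  ⟨h₁.symm, h₂.symm, h₄, h₃, h₅.symm, h₇, h₆⟩

theorem ColorBag.exchange {G₂ G₃ : SimpleGraph V} {f : V → ι} {a b c d : V}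
    (h : ColorBag G₂ G₃ f a b c d) : ColorBag G₃ G₂ f c d a b :=
  let ⟨h₁, h₂, h₃, h₄, h₅, h₆, h₇⟩ := h
  ⟨h₂, h₁, h₃.symm, h₄.symm, h₃ ▸ h₄ ▸ h₅, h₆.symm, h₇.symm⟩

/-- A colouring with `k` classes of size `l`, all other classes being singletons. -/
theorem exists_coloring_card_fiber [Fintype V] {k l r : ℕ} (hV : Fintype.card V = k * l + r) :
    ∃ f : V → Fin k ⊕ Fin r, ∀ i, #{v | f v = i} = Sum.elim (fun _ => l) (fun _ => 1) i := by
  have e : V ≃ (Fin k × Fin l) ⊕ Fin r := Fintype.equivOfCardEq (by simp [hV])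
  refine ⟨fun v => Sum.map Prod.fst id (e v), fun i => ?_⟩
  rw [card_equiv e (t := {p | Sum.map Prod.fst id p = i}) fun v => by simp]
  rcases i with i | j
  · calc _ = #((univ : Finset (Fin l)).map
          ⟨fun q => (Sum.inl (i, q) : (Fin k × Fin l) ⊕ Fin r), fun a b h => by simpa using h⟩) := by
          congr 1
          ext p
          rcases p with ⟨p, q⟩ | q <;> simp [DFunLike.coe, eq_comm]
      _ = _ := by simp
  · rw [show ({p | Sum.map Prod.fst id p = Sum.inr j} : Finset ((Fin k × Fin l) ⊕ Fin r)) =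
      {Sum.inr j} by ext p; rcases p with p | q <;> simp]
    simp

section SwapColors

variable [DecidableEq V]

/-- The colouring obtained from `f` by exchanging the colours of `x` and `y`. -/
def swapColors (f : V → ι) (x y : V) : V → ι := fun v => f (Equiv.swap x y v)

theorem swapColors_left (f : V → ι) (x y : V) : swapColors f x y x = f y := by
  simp [swapColors]

theorem swapColors_right (f : V → ι) (x y : V) : swapColors f x y y = f x := by
  simp [swapColors]

theorem swapColors_of_ne (f : V → ι) {x y v : V} (hx : v ≠ x) (hy : v ≠ y) :
    swapColors f x y v = f v := by
  simp [swapColors, Equiv.swap_apply_of_ne_of_ne hx hy]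

end SwapColors

variable [Fintype V] [DecidableEq V] [DecidableEq ι]

/-- The vertices having a neighbour in `S`. -/
def nbhd (G : SimpleGraph V) [DecidableRel G.Adj] (S : Finset V) : Finset V :=
  S.biUnion fun v => G.neighborFinset v

/-- The vertices sharing their colour with some vertex of `S`. -/
def colorHull (f : V → ι) (S : Finset V) : Finset V :=
  S.biUnion fun v => {y | f y = f v}

theorem mem_nbhd {G : SimpleGraph V} [DecidableRel G.Adj] {S : Finset V} {y : V} :
    y ∈ G.nbhd S ↔ ∃ v ∈ S, G.Adj v y := by
  simp [nbhd]

theorem mem_colorHull {f : V → ι} {S : Finset V} {y : V} :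
    y ∈ colorHull f S ↔ ∃ v ∈ S, f y = f v := by
  simp [colorHull]

theorem card_nbhd_le {G : SimpleGraph V} [DecidableRel G.Adj] {d n : ℕ}
    (hd : ∀ v, G.degree v ≤ d) {S : Finset V} (hS : #S ≤ n) : #(G.nbhd S) ≤ n * d :=
  (card_biUnion_le_card_mul _ _ _ fun v _ => hd v).trans (Nat.mul_le_mul_right _ hS)

theorem card_colorHull_le {f : V → ι} {l n : ℕ} (hf : ∀ i, #{v | f v = i} ≤ l)
    {S : Finset V} (hS : #S ≤ n) : #(colorHull f S) ≤ n * l :=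
  (card_biUnion_le_card_mul _ _ _ fun v _ => hf (f v)).trans (Nat.mul_le_mul_right _ hS)

theorem card_fiber_swapColors (f : V → ι) (x y : V) (i : ι) :
    #{v | swapColors f x y v = i} = #{v | f v = i} :=
  card_equiv (Equiv.swap x y) fun v => by
    rw [mem_filter, mem_filter]
    simp [swapColors]

theorem monochromatic_of_swapColors {H : SimpleGraph V} [DecidableRel H.Adj] {f : V → ι}
    {x y : V} (hxy : f y ≠ f x) (h₁ : y ∉ H.nbhd (colorHull f {x}))
    (h₂ : y ∉ colorHull f (H.nbhd {x})) {u v : V} (huv : H.Adj u v)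
    (h : swapColors f x y u = swapColors f x y v) : f u = f v ∧ u ≠ x := by
  have key : ∀ {u v : V}, H.Adj u v → swapColors f x y u = swapColors f x y v →
      u ≠ x ∧ u ≠ y := by
    intro u v huv h
    constructor
    · rintro rfl
      have hv : v ≠ y := by
        rintro rfl
        rw [swapColors_left, swapColors_right] at h
        exact hxy h
      rw [swapColors_left, swapColors_of_ne f huv.ne' hv] at h
      exact h₂ (mem_colorHull.2 ⟨v, mem_nbhd.2 ⟨u, by simp, huv⟩, h⟩)
    · rintro rfl
      have hv : v ≠ x := by
        rintro rfl
        rw [swapColors_left, swapColors_right] at h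
        exact hxy h.symm
      rw [swapColors_right, swapColors_of_ne f hv huv.ne'] at h
      exact h₁ (mem_nbhd.2 ⟨v, mem_colorHull.2 ⟨x, by simp, h.symm⟩, huv.symm⟩)
  obtain ⟨hux, huy⟩ := key huv h
  obtain ⟨hvx, hvy⟩ := key huv.symm h.symm
  rw [swapColors_of_ne f hux huy, swapColors_of_ne f hvx hvy] at h
  exact ⟨h, hux⟩

theorem ColorBag.ne_of_swapColors {G₂ G₃ : SimpleGraph V} [DecidableRel G₂.Adj]
    [DecidableRel G₃.Adj] {f : V → ι} (hf₃ : ∀ u v, G₃.Adj u v → f u ≠ f v) {x y : V}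
    (hxy : f y ≠ f x) (h₀ : y ∉ G₂.nbhd {x})
    (h₁ : y ∉ G₂.nbhd (colorHull f (G₃.nbhd (colorHull f {x}))))
    (h₂ : y ∉ colorHull f (G₃.nbhd (colorHull f (G₂.nbhd {x})))) {a b c d : V}
    (h : ColorBag G₂ G₃ (swapColors f x y) a b c d) : a ≠ x ∧ a ≠ y := by
  obtain ⟨hab, hcd, hac, hbd, hne, nac, nbd⟩ := h
  have h₀' : ¬ G₂.Adj x y := fun h => h₀ (mem_nbhd.2 ⟨x, by simp, h⟩)
  constructor
  · rintro rfl
    have hb : b ≠ y := by rintro rfl; exact h₀' hab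
    rw [swapColors_left] at hac hne
    have hcy : c ≠ y := by
      rintro rfl
      rw [swapColors_right] at hac
      exact hxy hac
    rw [swapColors_of_ne f nac.symm hcy] at hac
    rw [swapColors_of_ne f hab.ne' hb] at hbd hne
    have hdy : d ≠ y := by
      rintro rfl
      exact hf₃ _ _ hcd hac.symm
    have hdx : d ≠ a := by
      rintro rfl
      rw [swapColors_left] at hbd
      exact hne hbd.symm
    rw [swapColors_of_ne f hdx hdy] at hbd
    exact h₂ (mem_colorHull.2 ⟨c, mem_nbhd.2 ⟨d, mem_colorHull.2
      ⟨b, mem_nbhd.2 ⟨a, by simp, hab⟩, hbd.symm⟩, hcd.symm⟩, hac⟩)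
  · rintro rfl
    have hb : b ≠ x := by rintro rfl; exact h₀' hab.symm
    rw [swapColors_right] at hac hne
    have hcx : c ≠ x := by
      rintro rfl
      rw [swapColors_left] at hac
      exact hxy hac.symm
    rw [swapColors_of_ne f hcx nac.symm] at hac
    rw [swapColors_of_ne f hb hab.ne'] at hbd hne
    have hdx : d ≠ x := by
      rintro rfl
      exact hf₃ _ _ hcd hac.symm
    have hdy : d ≠ a := by
      rintro rfl
      rw [swapColors_right] at hbd
      exact hne hbd.symm
    rw [swapColors_of_ne f hdx hdy] at hbd
    exact h₁ (mem_nbhd.2 ⟨b, mem_colorHull.2 ⟨d, mem_nbhd.2 ⟨c, mem_colorHull.2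
      ⟨x, by simp, hac.symm⟩, hcd⟩, hbd⟩, hab.symm⟩)

theorem exists_proper_coloring {H : SimpleGraph V} [DecidableRel H.Adj] {D l : ℕ}
    (hD : ∀ v, H.degree v ≤ D) (hcard : l + 2 * l * D < Fintype.card V) {κ : ι → ℕ}
    (hκ : ∀ i, κ i ≤ l) {f : V → ι} (hf : ∀ i, #{v | f v = i} = κ i) :
    ∃ g : V → ι, (∀ i, #{v | g v = i} = κ i) ∧ ∀ u v, H.Adj u v → g u ≠ g v := by
  refine (exists_eq_empty_of_descent (fun f : V → ι => ∀ i, #{v | f v = i} = κ i)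
    (fun f => ({p | H.Adj p.1 p.2 ∧ f p.1 = f p.2} : Finset (V × V))) ?_ hf).imp
    fun g ⟨hg, hT⟩ => ⟨hg, fun u v huv h =>
      filter_eq_empty_iff.1 hT (mem_univ (u, v)) ⟨huv, h⟩⟩
  rintro f hf ⟨⟨x, z⟩, hxz⟩
  have hfl : ∀ i, #{v | f v = i} ≤ l := fun i => (hf i).trans_le (hκ i)
  have hx : #({x} : Finset V) ≤ 1 := by simp
  obtain ⟨y, hy⟩ : ∃ y, y ∉ colorHull f {x} ∪ H.nbhd (colorHull f {x}) ∪
      colorHull f (H.nbhd {x}) := by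
    by_contra! h
    have h₁ := card_colorHull_le hfl hx
    have h₂ := card_nbhd_le hD h₁
    have h₃ := card_colorHull_le hfl (card_nbhd_le hD hx)
    have h₄ := card_union_le (colorHull f {x} ∪ H.nbhd (colorHull f {x}))
      (colorHull f (H.nbhd {x}))
    have h₅ := card_union_le (colorHull f {x}) (H.nbhd (colorHull f {x}))
    rw [eq_univ_of_forall h, card_univ] at h₄
    nlinarith
  simp only [mem_union, not_or] at hy
  obtain ⟨⟨hy₀, hy₁⟩, hy₂⟩ := hy
  have hxy : f y ≠ f x := by simpa [mem_colorHull] using hy₀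
  refine ⟨swapColors f x y, fun i => by rw [card_fiber_swapColors, hf], ?_⟩
  refine (Finset.ssubset_iff_of_subset fun p hp => ?_).2 ⟨(x, z), hxz, fun hp => ?_⟩
  · simp only [mem_filter, mem_univ, true_and] at hp ⊢
    exact ⟨hp.1, (monochromatic_of_swapColors hxy hy₁ hy₂ hp.1 hp.2).1⟩
  · simp only [mem_filter, mem_univ, true_and] at hp
    exact (monochromatic_of_swapColors hxy hy₁ hy₂ hp.1 hp.2).2 rfl

theorem exists_proper_coloring_without_colorBag {H G₂ G₃ : SimpleGraph V} [DecidableRel H.Adj]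
    [DecidableRel G₂.Adj] [DecidableRel G₃.Adj] (hH₂ : G₂ ≤ H) (hH₃ : G₃ ≤ H) {D d₂ d₃ l : ℕ}
    (hD : ∀ v, H.degree v ≤ D) (hd₂ : ∀ v, G₂.degree v ≤ d₂) (hd₃ : ∀ v, G₃.degree v ≤ d₃)
    (hcard : l + 2 * l * D + 4 * l ^ 2 * (d₂ * d₃) + 2 * (d₂ * d₃) < Fintype.card V)
    {κ : ι → ℕ} (hκ : ∀ i, κ i ≤ l) {f : V → ι} (hf : ∀ i, #{v | f v = i} = κ i) :
    ∃ g : V → ι, (∀ i, #{v | g v = i} = κ i) ∧ (∀ u v, H.Adj u v → g u ≠ g v) ∧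
      ∀ a b c d, ¬ ColorBag G₂ G₃ g a b c d := by
  classical
  obtain ⟨f, hf⟩ := exists_proper_coloring hD (by omega) hκ hf
  refine (exists_eq_empty_of_descent
    (fun f : V → ι => (∀ i, #{v | f v = i} = κ i) ∧ ∀ u v, H.Adj u v → f u ≠ f v)
    (fun f => ({p | ColorBag G₂ G₃ f p.1 p.2.1 p.2.2.1 p.2.2.2} : Finset (V × V × V × V)))
    ?_ hf).imp fun g ⟨hg, hT⟩ => ⟨hg.1, hg.2, fun a b c d h =>
      filter_eq_empty_iff.1 hT (mem_univ (a, b, c, d)) h⟩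
  rintro f ⟨hf, hproper⟩ ⟨⟨x, b, c, d⟩, hbag⟩
  have hfl : ∀ i, #{v | f v = i} ≤ l := fun i => (hf i).trans_le (hκ i)
  have hx : #({x} : Finset V) ≤ 1 := by simp
  obtain ⟨y, hy⟩ : ∃ y, y ∉ (((colorHull f {x} ∪ H.nbhd (colorHull f {x})) ∪
      (colorHull f (H.nbhd {x}) ∪ G₂.nbhd {x})) ∪
      ((G₃.nbhd {x} ∪ G₂.nbhd (colorHull f (G₃.nbhd (colorHull f {x})))) ∪
      (G₃.nbhd (colorHull f (G₂.nbhd (colorHull f {x}))) ∪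
      colorHull f (G₃.nbhd (colorHull f (G₂.nbhd {x})))))) ∪
      colorHull f (G₂.nbhd (colorHull f (G₃.nbhd {x}))) := by
    by_contra! h
    have hpos₂ : 0 < d₂ := by
      have hadj : G₂.Adj x b := (mem_filter.1 hbag).2.1
      exact (G₂.degree_pos_iff_exists_adj x |>.2 ⟨b, hadj⟩).trans_le (hd₂ x)
    have hpos₃ : 0 < d₃ := by
      have hadj : G₃.Adj c d := (mem_filter.1 hbag).2.2.1
      exact (G₃.degree_pos_iff_exists_adj c |>.2 ⟨d, hadj⟩).trans_le (hd₃ c)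
    have hd₂' : d₂ ≤ d₂ * d₃ := Nat.le_mul_of_pos_right _ hpos₃
    have hd₃' : d₃ ≤ d₂ * d₃ := Nat.le_mul_of_pos_left _ hpos₂
    have hs₁ := card_colorHull_le hfl hx
    have hs₂ := card_nbhd_le hD hs₁
    have hs₃ := card_colorHull_le hfl (card_nbhd_le hD hx)
    have hs₄ := card_nbhd_le hd₂ hx
    have hs₅ := card_nbhd_le hd₃ hx
    have hs₆ := card_nbhd_le hd₂ (card_colorHull_le hfl (card_nbhd_le hd₃ hs₁))
    have hs₇ := card_nbhd_le hd₃ (card_colorHull_le hfl (card_nbhd_le hd₂ hs₁))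
    have hs₈ := card_colorHull_le hfl (card_nbhd_le hd₃ (card_colorHull_le hfl hs₄))
    have hs₉ := card_colorHull_le hfl (card_nbhd_le hd₂ (card_colorHull_le hfl hs₅))
    have huniv := congrArg card (eq_univ_of_forall h)
    rw [card_univ] at huniv
    have hle := huniv.ge.trans <| (card_union_le _ _).trans <| add_le_add
      ((card_union_le _ _).trans <| add_le_add
        ((card_union_le _ _).trans <| add_le_add
          ((card_union_le _ _).trans <| add_le_add hs₁ hs₂)
          ((card_union_le _ _).trans <| add_le_add hs₃ hs₄))
        ((card_union_le _ _).trans <| add_le_add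
          ((card_union_le _ _).trans <| add_le_add hs₅ hs₆)
          ((card_union_le _ _).trans <| add_le_add hs₇ hs₈))) hs₉
    linarith
  simp only [mem_union, not_or] at hy
  obtain ⟨⟨⟨⟨hy₁, hy₂⟩, hy₃, hy₄⟩, ⟨hy₅, hy₆⟩, hy₇, hy₈⟩, hy₉⟩ := hy
  have hxy : f y ≠ f x := by simpa [mem_colorHull] using hy₁
  have key₂ {a b c d : V} (h : ColorBag G₂ G₃ (swapColors f x y) a b c d) : a ≠ x ∧ a ≠ y :=
    h.ne_of_swapColors (fun u v h => hproper u v (hH₃ h)) hxy hy₄ hy₆ hy₈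
  have key₃ {a b c d : V} (h : ColorBag G₃ G₂ (swapColors f x y) a b c d) : a ≠ x ∧ a ≠ y :=
    h.ne_of_swapColors (fun u v h => hproper u v (hH₂ h)) hxy hy₅ hy₇ hy₉
  refine ⟨swapColors f x y, ⟨fun i => by rw [card_fiber_swapColors, hf], fun u v huv h =>
    hproper u v huv (monochromatic_of_swapColors hxy hy₂ hy₃ huv h).1⟩, ?_⟩
  refine (Finset.ssubset_iff_of_subset ?_).2 ⟨(x, b, c, d), hbag, fun hp => ?_⟩
  · rintro ⟨a, b, c, d⟩ hp
    simp only [mem_filter, mem_univ, true_and] at hp ⊢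
    have ha := key₂ hp
    have hb := key₂ hp.flip
    have hc := key₃ hp.exchange
    have hd := key₃ hp.flip.exchange
    simpa only [ColorBag, swapColors_of_ne f ha.1 ha.2, swapColors_of_ne f hb.1 hb.2,
      swapColors_of_ne f hc.1 hc.2, swapColors_of_ne f hd.1 hd.2] using hp
  · simp only [mem_filter, mem_univ, true_and] at hp
    exact (key₂ hp).1 rfl

end SimpleGraph

open SimpleGraph in
theorem stmt1 {V : Type*} [Fintype V] [DecidableEq V]
    (G₁ G₂ G₃ : SimpleGraph V)
    [DecidableRel G₁.Adj] [DecidableRel G₂.Adj] [DecidableRel G₃.Adj]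
    (ℓ : ℕ) (hℓ : 2 ≤ ℓ) (m : ℕ) (hm : Fintype.card V = m)
    (h12 : ∀ u v : V, ¬ (G₁.Adj u v ∧ G₂.Adj u v))
    (h13 : ∀ u v : V, ¬ (G₁.Adj u v ∧ G₃.Adj u v))
    (hδ : (m : ℝ) * (3 * ℓ - 1) / (3 * ℓ) ≤ (G₁.minDegree : ℝ))
    (hΔ : (G₂.maxDegree : ℝ) * (G₃.maxDegree : ℝ) ≤ ((m : ℝ) - 3) / (15 * (ℓ : ℝ) ^ 2)) :
    ∃ F : Finset (Finset V),
      F.card = m / ℓ ∧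
      (∀ s ∈ F, G₁.IsNClique ℓ s) ∧
      (∀ s ∈ F, ∀ t ∈ F, s ≠ t → Disjoint s t) ∧
      (∀ s ∈ F, ∀ t ∈ F, s ≠ t → ¬ AltBag G₂ G₃ s t) := by
  subst hm
  set m := Fintype.card V with hm
  have hl : (2 : ℝ) ≤ ℓ := by exact_mod_cast hℓ
  have hP : 15 * ℓ ^ 2 * (G₂.maxDegree * G₃.maxDegree) + 3 ≤ m := by
    rw [le_div_iff₀ (by positivity)] at hΔ
    have : (15 * ℓ ^ 2 * (G₂.maxDegree * G₃.maxDegree) + 3 : ℝ) ≤ m := by linarith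
    exact_mod_cast this
  have : Nonempty V := Fintype.card_pos_iff.1 (by omega)
  obtain ⟨D, hD⟩ : ∃ D, m = G₁.minDegree + 1 + D :=
    Nat.exists_eq_add_of_le (G₁.minDegree_lt_card)
  have hDm : 3 * ℓ * (D + 1) ≤ m := by
    rw [div_le_iff₀ (by positivity)] at hδ
    have hD' : (m : ℝ) = G₁.minDegree + 1 + D := by exact_mod_cast hD
    have : (3 * ℓ * (D + 1) : ℝ) ≤ m := by
      have : (G₁.minDegree : ℝ) = m - 1 - D := by linarith
      rw [this] at hδ
      linarith
    exact_mod_cast this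
  have hdeg : ∀ v, G₁ᶜ.degree v ≤ D := fun v => by
    have := G₁.minDegree_le_degree v
    rw [degree_compl]
    omega
  have hle₂ : G₂ ≤ G₁ᶜ := fun u v h => (compl_adj ..).2 ⟨h.ne, fun h' => h12 u v ⟨h', h⟩⟩
  have hle₃ : G₃ ≤ G₁ᶜ := fun u v h => (compl_adj ..).2 ⟨h.ne, fun h' => h13 u v ⟨h', h⟩⟩
  obtain ⟨f₀, hf₀⟩ := exists_coloring_card_fiber (V := V) (k := m / ℓ) (l := ℓ) (r := m % ℓ)
    (Nat.div_add_mod' m ℓ).symm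
  obtain ⟨f, hf, hproper, hbag⟩ := exists_proper_coloring_without_colorBag (l := ℓ) hle₂ hle₃ hdeg
    G₂.degree_le_maxDegree G₃.degree_le_maxDegree
    (by
      rw [← hm]
      generalize G₂.maxDegree * G₃.maxDegree = P at *
      have : 4 * P ≤ ℓ ^ 2 * P := Nat.mul_le_mul_right _ (by nlinarith)
      nlinarith)
    (by rintro (i | i) <;> simp; omega) hf₀
  have hinj : Function.Injective fun i : Fin (m / ℓ) => ({v | f v = Sum.inl i} : Finset V) := by
    intro i j hij
    obtain ⟨v, hv⟩ : ({v | f v = Sum.inl i} : Finset V).Nonempty := by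
      rw [← card_pos, hf]
      simp
      omega
    have hv' := hv
    rw [show ({v | f v = Sum.inl i} : Finset V) = _ from hij] at hv'
    simp only [mem_filter, mem_univ, true_and] at hv hv'
    exact Sum.inl_injective (hv.symm.trans hv')
  refine ⟨univ.map ⟨_, hinj⟩, by simp, ?_, ?_, ?_⟩
  · simp only [mem_map, mem_univ, true_and, Function.Embedding.coeFn_mk]
    rintro _ ⟨i, rfl⟩
    refine ⟨fun u hu v hv huv => ?_, hf _⟩
    simp only [coe_filter, mem_univ, true_and, Set.mem_ofPred_eq] at hu hv
    by_contra h
    exact hproper u v ((compl_adj ..).2 ⟨huv, h⟩) (hu.trans hv.symm)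
  · simp only [mem_map, mem_univ, true_and, Function.Embedding.coeFn_mk]
    rintro _ ⟨i, rfl⟩ _ ⟨j, rfl⟩ hij
    refine disjoint_left.2 fun v hv hv' => hij ?_
    simp only [mem_filter, mem_univ, true_and] at hv hv'
    rw [← hv, hv']
  · simp only [mem_map, mem_univ, true_and, Function.Embedding.coeFn_mk]
    rintro _ ⟨i, rfl⟩ _ ⟨j, rfl⟩ hij ⟨a, b, c, d, ha, hb, hc, hd, hab, hcd, hac, -, -, hbd⟩
    simp only [mem_filter, mem_univ, true_and] at ha hb hc hd
    refine hbag a b c d ⟨hab, hcd, ha.trans hc.symm, hb.trans hd.symm, fun h => hij ?_, hac, hbd⟩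
    rw [← ha, h, hb]
end

section
/- Let ℓ ≥ 2 be an integer and let G be a simple graph on m vertices with minimum degree δ. If m(3ℓ−1)/(3ℓ) ≤ δ, then G has an almost-ℓ-decomposition, i.e., there exist ⌊m/ℓ⌋ pairwise vertex-disjoint ℓ-cliques in G. -/
/-- A partial coloring with `k` colors, all of whose color classes are cliques of size at most `ℓ`. -/
structure IsCliqueColoring {V : Type*} [Fintype V] (G : SimpleGraph V) (ℓ k : ℕ)
    (f : V → Option (Fin k)) : Prop where
  adj : ∀ i u v, f u = some i → f v = some i → u ≠ v → G.Adj u v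
  card_le : ∀ i, (Finset.univ.filter fun u => f u = some i).card ≤ ℓ

theorem disjoint_colorClass {V : Type*} [Fintype V] {k : ℕ} (f : V → Option (Fin k))
    {i j : Fin k} (hij : i ≠ j) :
    Disjoint (Finset.univ.filter fun u => f u = some i)
      (Finset.univ.filter fun u => f u = some j) := by
  rw [Finset.disjoint_left]
  intro u hu hu'
  simp only [Finset.mem_filter, Finset.mem_univ, true_and] at hu hu'
  exact hij (Option.some.inj (hu.symm.trans hu'))

/-- The number of colored vertices is the sum of the sizes of the color classes. -/
theorem card_colored_eq_sum {V : Type*} [Fintype V] {k : ℕ} (f : V → Option (Fin k)) :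
    (Finset.univ.filter fun u => f u ≠ none).card =
      ∑ i, (Finset.univ.filter fun u => f u = some i).card := by
  classical
  rw [← Finset.card_biUnion]
  · congr 1
    ext u
    simp [Option.ne_none_iff_exists']
  · exact fun i _ j _ hij => disjoint_colorClass f hij

namespace IsCliqueColoring

variable {V : Type*} [Fintype V] [DecidableEq V] {G : SimpleGraph V} {ℓ k : ℕ}
  {f : V → Option (Fin k)}

/-- An uncolored vertex adjacent to all of a deficient color class can be given that color. -/
theorem update (hf : IsCliqueColoring G ℓ k f) {v : V} {i : Fin k}
    (hi : (Finset.univ.filter fun u => f u = some i).card < ℓ)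
    (hvi : ∀ u, f u = some i → G.Adj v u) :
    IsCliqueColoring G ℓ k (Function.update f v (some i)) where
  adj j a b ha hb hab := by
    have := hf.adj j a b
    have := fun u h => (hvi u h).symm
    simp only [Function.update_apply] at ha hb
    split_ifs at ha hb <;> grind
  card_le j := by
    by_cases hj : j = i
    · subst hj
      refine le_trans (Finset.card_le_card (t := insert v
        (Finset.univ.filter fun u => f u = some j)) ?_)
        ((Finset.card_insert_le _ _).trans hi)
      intro u
      simp only [Finset.mem_filter, Finset.mem_univ, true_and, Finset.mem_insert,
        Function.update_apply]
      grind
    · refine le_trans (Finset.card_le_card ?_) (hf.card_le j)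
      intro u
      simp only [Finset.mem_filter, Finset.mem_univ, true_and, Function.update_apply]
      grind

/-- Uncoloring a vertex. -/
theorem erase (hf : IsCliqueColoring G ℓ k f) (w : V) :
    IsCliqueColoring G ℓ k (Function.update f w none) where
  adj j a b ha hb hab := by
    simp only [Function.update_apply] at ha hb
    have := hf.adj j a b
    grind
  card_le j := by
    refine le_trans (Finset.card_le_card ?_) (hf.card_le j)
    intro u
    simp only [Finset.mem_filter, Finset.mem_univ, true_and, Function.update_apply]
    grind

/-- An uncolored vertex `v` takes over the color of `w`, and `w` moves to a deficient class. -/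
theorem swap (hf : IsCliqueColoring G ℓ k f) {v w : V} {i j : Fin k} (hij : i ≠ j)
    (hv : f v = none) (hw : f w = some j)
    (hi : (Finset.univ.filter fun u => f u = some i).card < ℓ)
    (hvj : ∀ u, f u = some j → G.Adj v u) (hwi : ∀ u, f u = some i → G.Adj w u) :
    IsCliqueColoring G ℓ k
      (Function.update (Function.update (Function.update f w none) v (some j)) w (some i)) := by
  have hvw : v ≠ w := by rintro rfl; simp [hv] at hw
  refine update (update (hf.erase w) ?_ ?_) ?_ ?_
  · refine lt_of_lt_of_le (Finset.card_lt_card (t := Finset.univ.filter fun u => f u = some j) ?_)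
      (hf.card_le j)
    rw [Finset.ssubset_iff_of_subset]
    · exact ⟨w, by simp [hw], by simp⟩
    · intro u
      simp only [Finset.mem_filter, Finset.mem_univ, true_and, Function.update_apply]
      grind
  · intro u hu
    simp only [Function.update_apply] at hu
    grind
  · refine lt_of_le_of_lt (Finset.card_le_card ?_) hi
    intro u
    simp only [Finset.mem_filter, Finset.mem_univ, true_and, Function.update_apply]
    grind
  · intro u hu
    simp only [Function.update_apply] at hu
    grind

/-- If every vertex has few non-neighbors, a clique coloring that is not full can be extended to
one more vertex. -/
theorem exists_extension (hf : IsCliqueColoring G ℓ k f) [DecidableRel G.Adj] {N : ℕ}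
    (hN : ∀ v, (Finset.univ.filter fun u => ¬ G.Adj v u).card ≤ N) (hk : 2 * N ≤ k)
    (hkℓ : k * ℓ ≤ Fintype.card V)
    (hlt : (Finset.univ.filter fun u => f u ≠ none).card < k * ℓ) :
    ∃ g : V → Option (Fin k), IsCliqueColoring G ℓ k g ∧
      (Finset.univ.filter fun u => g u ≠ none).card =
        (Finset.univ.filter fun u => f u ≠ none).card + 1 := by
  obtain ⟨v, hv⟩ : ∃ v, f v = none := by
    by_contra! h
    rw [Finset.filter_true_of_mem fun u _ => h u, Finset.card_univ] at hlt
    omega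
  have hcard (g : V → Option (Fin k)) (hg : ∀ u, g u ≠ none ↔ f u ≠ none ∨ u = v) :
      (Finset.univ.filter fun u => g u ≠ none).card =
        (Finset.univ.filter fun u => f u ≠ none).card + 1 := by
    rw [← Finset.card_insert_of_notMem (a := v) (by simp [hv])]
    congr 1
    ext u
    have := hg u
    simp only [Finset.mem_filter, Finset.mem_univ, true_and, Finset.mem_insert]
    tauto
  obtain ⟨i, hi⟩ : ∃ i, (Finset.univ.filter fun u => f u = some i).card < ℓ := by
    by_contra! h
    rw [card_colored_eq_sum] at hlt
    have := Finset.card_nsmul_le_sum Finset.univ _ ℓ fun i _ => h i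
    simp only [Finset.card_univ, Fintype.card_fin, smul_eq_mul] at this
    omega
  by_cases hfree : ∃ j, (Finset.univ.filter fun u => f u = some j).card < ℓ ∧
      ∀ u, f u = some j → G.Adj v u
  · obtain ⟨j, hj, hvj⟩ := hfree
    refine ⟨_, hf.update hj hvj, hcard _ fun u => ?_⟩
    simp only [Function.update_apply]
    grind
  push Not at hfree
  let J : Finset (Fin k) := Finset.univ.filter fun j => ∀ u, f u = some j → G.Adj v u
  have hJ : k - N ≤ J.card := by
    have hJc : Jᶜ.card ≤ N := by
      refine le_trans ?_ (hN v)
      refine le_trans ?_ (Finset.card_image_le (f := f))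
      rw [← Finset.card_image_of_injective Jᶜ (Option.some_injective _)]
      refine Finset.card_le_card fun x hx => ?_
      simp only [J, Finset.mem_image, Finset.mem_compl, Finset.mem_filter, Finset.mem_univ,
        true_and, not_forall] at hx ⊢
      obtain ⟨j, ⟨u, hu, huv⟩, rfl⟩ := hx
      exact ⟨u, huv, hu⟩
    rw [Finset.card_compl, Fintype.card_fin] at hJc
    omega
  have hfull : ∀ j ∈ J, ℓ ≤ (Finset.univ.filter fun u => f u = some j).card := by
    intro j hj
    by_contra! h
    obtain ⟨u, hu, huv⟩ := hfree j h
    exact huv ((Finset.mem_filter.1 hj).2 u hu)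
  let W := J.biUnion fun j => Finset.univ.filter fun u => f u = some j
  have hW : (k - N) * ℓ ≤ W.card := by
    rw [Finset.card_biUnion]
    · exact (Nat.mul_le_mul_right ℓ hJ).trans (Finset.card_nsmul_le_sum J _ ℓ hfull)
    · exact fun a _ b _ hab => disjoint_colorClass f hab
  let B := (Finset.univ.filter fun u => f u = some i).biUnion
    fun c => Finset.univ.filter fun u => ¬ G.Adj c u
  have hB : B.card ≤ (ℓ - 1) * N :=
    (Finset.card_biUnion_le_card_mul _ _ N fun c _ => hN c).trans
      (Nat.mul_le_mul_right N (by omega))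
  have hN0 : 0 < N := (Finset.card_pos.2 ⟨v, by simp⟩).trans_le (hN v)
  have hBW : B.card < W.card := by
    calc B.card ≤ (ℓ - 1) * N := hB
      _ < ℓ * N := Nat.mul_lt_mul_of_pos_right (by omega) hN0
      _ = N * ℓ := mul_comm _ _
      _ ≤ (k - N) * ℓ := Nat.mul_le_mul_right ℓ (by omega)
      _ ≤ W.card := hW
  obtain ⟨w, hwW, hwB⟩ := Finset.exists_mem_notMem_of_card_lt_card hBW
  simp only [W, B, J, Finset.mem_biUnion, Finset.mem_filter, Finset.mem_univ, true_and,
    not_exists, not_and, not_not] at hwW hwB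
  obtain ⟨j, hvj, hwj⟩ := hwW
  have hij : i ≠ j := by
    rintro rfl
    obtain ⟨u, hu, huv⟩ := hfree i hi
    exact huv (hvj u hu)
  refine ⟨_, hf.swap hij hv hwj hi hvj fun u hu => (hwB u hu).symm, hcard _ fun u => ?_⟩
  simp only [Function.update_apply]
  grind

end IsCliqueColoring

/-- If every vertex has at most `N` non-neighbors (itself included), then there is a clique
coloring with `k ≥ 2 * N` colors, all of whose classes have size exactly `ℓ`. -/
theorem exists_full_isCliqueColoring {V : Type*} [Fintype V] [DecidableEq V]
    {G : SimpleGraph V} [DecidableRel G.Adj] {ℓ k N : ℕ}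
    (hN : ∀ v, (Finset.univ.filter fun u => ¬ G.Adj v u).card ≤ N) (hk : 2 * N ≤ k)
    (hkℓ : k * ℓ ≤ Fintype.card V) :
    ∃ f : V → Option (Fin k), IsCliqueColoring G ℓ k f ∧
      ∀ i, (Finset.univ.filter fun u => f u = some i).card = ℓ := by
  have h (n : ℕ) (hn : n ≤ k * ℓ) : ∃ f : V → Option (Fin k), IsCliqueColoring G ℓ k f ∧
      (Finset.univ.filter fun u => f u ≠ none).card = n := by
    induction n with
    | zero => exact ⟨fun _ => none, ⟨by simp, by simp⟩, by simp⟩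
    | succ n ih =>
      obtain ⟨f, hf, rfl⟩ := ih (by omega)
      exact hf.exists_extension hN hk hkℓ hn
  obtain ⟨f, hf, hc⟩ := h _ le_rfl
  refine ⟨f, hf, fun i => ?_⟩
  rw [card_colored_eq_sum] at hc
  exact (Finset.sum_eq_sum_iff_of_le fun j _ => hf.card_le j).1 (by simp [hc]) i
    (Finset.mem_univ i)

theorem stmt2 {V : Type*} [Fintype V] [DecidableEq V]
    (G : SimpleGraph V) [DecidableRel G.Adj]
    (ℓ : ℕ) (hℓ : 2 ≤ ℓ) (m : ℕ) (hm : Fintype.card V = m)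
    (hδ : (m : ℝ) * (3 * ℓ - 1) / (3 * ℓ) ≤ (G.minDegree : ℝ)) :
    ∃ F : Finset (Finset V),
      F.card = m / ℓ ∧
      (∀ s ∈ F, G.IsNClique ℓ s) ∧
      (∀ s ∈ F, ∀ t ∈ F, s ≠ t → Disjoint s t) := by
  have hbound : 3 * (m - G.minDegree) ≤ m / ℓ := by
    rw [Nat.le_div_iff_mul_le (by omega)]
    have hpos : (0 : ℝ) < 3 * ℓ := by positivity
    rw [div_le_iff₀ hpos] at hδ
    rcases le_total m G.minDegree with h | h
    · simp [Nat.sub_eq_zero_of_le h]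
    · rify [h]
      linarith
  have hN (v : V) : (Finset.univ.filter fun u => ¬ G.Adj v u).card ≤ m - G.minDegree := by
    have h := Finset.card_filter_add_card_filter_not (s := Finset.univ) (G.Adj v)
    rw [← G.neighborFinset_eq_filter, G.card_neighborFinset_eq_degree, Finset.card_univ, hm] at h
    have := G.minDegree_le_degree v
    omega
  obtain ⟨f, hf, hcard⟩ := exists_full_isCliqueColoring (k := m / ℓ) (ℓ := ℓ) hN (by omega)
    (hm ▸ Nat.div_mul_le_self m ℓ)
  refine ⟨Finset.univ.image fun i => Finset.univ.filter fun u => f u = some i, ?_, ?_, ?_⟩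
  · rw [Finset.card_image_of_injective, Finset.card_univ, Fintype.card_fin]
    intro i j hij
    obtain ⟨u, hu⟩ := Finset.card_pos.1 ((hcard i).symm ▸ (by omega : 0 < ℓ))
    have hu' := hu
    simp only at hij
    rw [hij] at hu'
    simp only [Finset.mem_filter, Finset.mem_univ, true_and] at hu hu'
    exact Option.some.inj (hu.symm.trans hu')
  · simp only [Finset.mem_image, Finset.mem_univ, true_and, forall_exists_index,
      forall_apply_eq_imp_iff]
    refine fun i => ⟨?_, hcard i⟩
    intro a ha b hb hab
    simp only [Finset.coe_filter, Finset.mem_univ, true_and, Set.mem_ofPred_eq] at ha hb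
    exact hf.adj i a b ha hb hab
  · simp only [Finset.mem_image, Finset.mem_univ, true_and, forall_exists_index,
      forall_apply_eq_imp_iff]
    exact fun i j hij => disjoint_colorClass f (by rintro rfl; exact hij rfl)
end

section
/- Let ℓ ≥ 2 and q ≥ 1 be integers and let G be a simple graph on m vertices with minimum degree δ satisfying m·(((2ℓ−1)²−1)/(2ℓ−1)²) + (4ℓ−3+q)/(2ℓ−1)² ≤ δ. Fix any cyclic ordering v_0, v_1, ..., v_{m−1} of the vertices of G, and fix a window C0 of 2ℓ−1 cyclically consecutive vertices. Then there exist at least q windows of 2ℓ−1 cyclically consecutive vertices, each vertex-disjoint from C0, such that every vertex of each such window is adjacent in G to every vertex of C0 (i.e., each such window spans a complete bipartite graph K_{2ℓ−1,2ℓ−1} with C0 in G). -/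
/-- The window of `r` cyclically consecutive vertices `{e i, e (i+1), …, e (i+r-1)}`
of a cyclic ordering `e : ZMod m ≃ V`. -/
def cycWindow {V : Type*} [DecidableEq V] (m : ℕ) (e : ZMod m ≃ V)
    (i : ZMod m) (r : ℕ) : Finset V :=
  (Finset.range r).image fun t : ℕ => e (i + (t : ZMod m))

/-- The number of positions `j` such that the vertex `s` places after `j` is not adjacent to `w` is
the number of non-neighbours of `w`. -/
lemma card_not_adj_shift_add_degree {V : Type*} [Fintype V] (G : SimpleGraph V)
    [DecidableRel G.Adj] {m : ℕ} [NeZero m] (e : ZMod m ≃ V) (s : ZMod m) (w : V) :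
    (Finset.univ.filter fun j : ZMod m => ¬ G.Adj (e (j + s)) w).card + G.degree w = m := by
  have h : (Finset.univ.filter fun j : ZMod m => G.Adj (e (j + s)) w).card = G.degree w := by
    rw [← G.card_neighborFinset_eq_degree]
    refine Finset.card_equiv ((Equiv.addRight s).trans e) fun j => ?_
    simp [G.adj_comm]
  rw [← h, add_comm, Finset.card_filter_add_card_filter_not, Finset.card_univ, ZMod.card]

theorem stmt7 {V : Type*} [Fintype V] [DecidableEq V]
    (G : SimpleGraph V) [DecidableRel G.Adj]
    (ℓ q : ℕ) (hℓ : 2 ≤ ℓ) (hq : 1 ≤ q) (m : ℕ) (hm : Fintype.card V = m)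
    (hδ : (m : ℝ) * (((2 * (ℓ : ℝ) - 1) ^ 2 - 1) / (2 * (ℓ : ℝ) - 1) ^ 2) +
        (4 * (ℓ : ℝ) - 3 + q) / (2 * (ℓ : ℝ) - 1) ^ 2 ≤ (G.minDegree : ℝ))
    (e : ZMod m ≃ V) (i₀ : ZMod m) :
    ∃ S : Finset (ZMod m), q ≤ S.card ∧
      ∀ j ∈ S,
        Disjoint (cycWindow m e j (2 * ℓ - 1)) (cycWindow m e i₀ (2 * ℓ - 1)) ∧
        ∀ u ∈ cycWindow m e j (2 * ℓ - 1), ∀ w ∈ cycWindow m e i₀ (2 * ℓ - 1),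
          G.Adj u w := by
  obtain hm0 | hm0 := Nat.eq_zero_or_pos m
  · have := Fintype.card_eq_zero_iff.1 (hm.trans hm0)
    exact (this.false (e i₀)).elim
  have : NeZero m := ⟨hm0.ne'⟩
  obtain ⟨r, hr⟩ : ∃ r, r = 2 * ℓ - 1 := ⟨_, rfl⟩
  have hrR : (r : ℝ) = 2 * (ℓ : ℝ) - 1 := by
    rw [hr, Nat.cast_sub (by omega)]
    push_cast
    ring
  have hr1 : (1 : ℝ) ≤ r := by exact_mod_cast (by omega : 1 ≤ r)
  rw [← hr]
  let bad : ℕ × ℕ → Finset (ZMod m) := fun p =>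
    Finset.univ.filter fun j => ¬ G.Adj (e (j + (p.1 : ZMod m))) (e (i₀ + (p.2 : ZMod m)))
  let B := (Finset.range r ×ˢ Finset.range r).biUnion bad
  have hB : B.card ≤ r * r * (m - G.minDegree) := by
    have h := Finset.card_biUnion_le_card_mul (Finset.range r ×ˢ Finset.range r) bad
      (m - G.minDegree) fun p _ => by
        have h₁ : (bad p).card + G.degree (e (i₀ + (p.2 : ZMod m))) = m :=
          card_not_adj_shift_add_degree G e p.1 (e (i₀ + (p.2 : ZMod m)))
        have h₂ := G.minDegree_le_degree (e (i₀ + (p.2 : ZMod m)))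
        omega
    rwa [Finset.card_product, Finset.card_range] at h
  have hδm : G.minDegree ≤ m :=
    (G.minDegree_le_degree (e i₀)).trans (hm ▸ (G.degree_lt_card_verts (e i₀)).le)
  have hcompl : Bᶜ.card + B.card = m := by
    rw [Finset.card_compl_add_card, ZMod.card]
  refine ⟨Bᶜ, ?_, fun j hj => ?_⟩
  · have hmain : (m : ℝ) * ((r : ℝ) ^ 2 - 1) + (2 * r - 1 + q) ≤ G.minDegree * (r : ℝ) ^ 2 := by
      rw [← hrR, mul_div_assoc', ← add_div, div_le_iff₀ (by positivity)] at hδ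
      linarith
    have hB' : (B.card : ℝ) ≤ r * r * (m - G.minDegree) := by
      rw [← Nat.cast_sub hδm]
      exact_mod_cast hB
    have hcompl' : (Bᶜ.card : ℝ) + B.card = m := by exact_mod_cast hcompl
    have : (q : ℝ) ≤ Bᶜ.card := by nlinarith
    exact_mod_cast this
  · have hadj : ∀ u ∈ cycWindow m e j r, ∀ w ∈ cycWindow m e i₀ r, G.Adj u w := by
      intro u hu w hw
      simp only [cycWindow, Finset.mem_image, Finset.mem_range] at hu hw
      obtain ⟨s, hs, rfl⟩ := hu
      obtain ⟨t, ht, rfl⟩ := hw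
      by_contra h
      refine Finset.mem_compl.1 hj (Finset.mem_biUnion.2 ⟨(s, t), ?_, ?_⟩)
      · simp [hs, ht]
      · simpa [bad] using h
    exact ⟨Finset.disjoint_left.2 fun u hu hu' => G.loopless.irrefl u (hadj u hu u hu'), hadj⟩
end

section
/- Let ℓ ≥ 2 and q ≥ 1 be integers and let G be a simple graph on m vertices with minimum degree δ satisfying m·(((2ℓ−1)²−1)/(2ℓ−1)²) + (4ℓ−3+q)/(2ℓ−1)² ≤ δ. Fix any cyclic ordering v_0, v_1, ..., v_{m−1} of the vertices of G, let r be an integer with 1 ≤ r ≤ 2ℓ−2, and fix a window C1 of r cyclically consecutive vertices. Then there exists a window C2 of r cyclically consecutive vertices, vertex-disjoint from C1, such that every vertex of C2 is adjacent in G to every vertex of C1 (i.e., C1 and C2 span a complete bipartite graph K_{r,r} in G). -/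
theorem SimpleGraph.card_not_adj_add_minDegree_le {V : Type*} [Fintype V]
    (G : SimpleGraph V) [DecidableRel G.Adj] (w : V) :
    (Finset.univ.filter fun u => ¬ G.Adj w u).card + G.minDegree ≤ Fintype.card V := by
  have h := Finset.card_filter_add_card_filter_not (s := (Finset.univ : Finset V)) (G.Adj w)
  have hdeg : (Finset.univ.filter (G.Adj w)).card = G.degree w := by
    rw [← G.card_neighborFinset_eq_degree, G.neighborFinset_eq_filter]
  have hmin := G.minDegree_le_degree w
  rw [Finset.card_univ] at h
  omega

/-- If every vertex has few non-neighbours, some window is completely joined to a given window. -/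
theorem exists_forall_adj_of_sq_mul_lt {V : Type*} [Fintype V]
    (G : SimpleGraph V) [DecidableRel G.Adj] (m : ℕ) [NeZero m] (hm : Fintype.card V = m)
    (e : ZMod m ≃ V) (r : ℕ) (i : ZMod m) (h : r * r * (m - G.minDegree) < m) :
    ∃ j : ZMod m, ∀ t < r, ∀ s < r, G.Adj (e (j + (t : ZMod m))) (e (i + (s : ZMod m))) := by
  by_contra! hcon
  let bad : ℕ × ℕ → Finset (ZMod m) := fun p =>
    Finset.univ.filter fun j => ¬ G.Adj (e (i + (p.2 : ZMod m))) (e (j + (p.1 : ZMod m)))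
  have hbad (p : ℕ × ℕ) : (bad p).card ≤ m - G.minDegree := by
    have hle : (bad p).card ≤
        (Finset.univ.filter fun u => ¬ G.Adj (e (i + (p.2 : ZMod m))) u).card := by
      refine Finset.card_le_card_of_injOn (fun j => e (j + (p.1 : ZMod m))) ?_ ?_
      · intro j hj
        simpa [bad] using hj
      · intro a _ b _ hab
        simpa using hab
    have := G.card_not_adj_add_minDegree_le (e (i + (p.2 : ZMod m)))
    omega
  have hcover : (Finset.univ : Finset (ZMod m)) ⊆
      (Finset.range r ×ˢ Finset.range r).biUnion bad := by
    intro j _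
    obtain ⟨t, ht, s, hs, hts⟩ := hcon j
    simp only [Finset.mem_biUnion, Finset.mem_product, Finset.mem_range]
    exact ⟨(t, s), ⟨ht, hs⟩, by simpa [bad, G.adj_comm] using hts⟩
  have hcard := (Finset.card_le_card hcover).trans
    (Finset.card_biUnion_le_card_mul _ bad _ fun p _ => hbad p)
  rw [Finset.card_univ, ZMod.card, Finset.card_product, Finset.card_range] at hcard
  omega

theorem stmt8 {V : Type*} [Fintype V] [DecidableEq V]
    (G : SimpleGraph V) [DecidableRel G.Adj]
    (ℓ q : ℕ) (hℓ : 2 ≤ ℓ) (hq : 1 ≤ q) (m : ℕ) (hm : Fintype.card V = m)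
    (hδ : (m : ℝ) * (((2 * (ℓ : ℝ) - 1) ^ 2 - 1) / (2 * (ℓ : ℝ) - 1) ^ 2) +
        (4 * (ℓ : ℝ) - 3 + q) / (2 * (ℓ : ℝ) - 1) ^ 2 ≤ (G.minDegree : ℝ))
    (e : ZMod m ≃ V) (r : ℕ) (hr1 : 1 ≤ r) (hr2 : r ≤ 2 * ℓ - 2) (i₁ : ZMod m) :
    ∃ j : ZMod m,
      Disjoint (cycWindow m e j r) (cycWindow m e i₁ r) ∧
      ∀ u ∈ cycWindow m e j r, ∀ w ∈ cycWindow m e i₁ r, G.Adj u w := by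
  have : Nonempty V := ⟨e i₁⟩
  have hm0 : NeZero m := ⟨by rw [← hm]; exact Fintype.card_ne_zero⟩
  have hδm : G.minDegree ≤ m :=
    hm ▸ (G.minDegree_le_degree (e i₁)).trans (G.degree_lt_card_verts _).le
  have hlt : r * r * (m - G.minDegree) < m := by
    have hℓ' : (2 : ℝ) ≤ ℓ := by exact_mod_cast hℓ
    have hq' : (1 : ℝ) ≤ q := by exact_mod_cast hq
    have hδm' : (G.minDegree : ℝ) ≤ m := by exact_mod_cast hδm
    have hr : (r : ℝ) ≤ 2 * ℓ - 1 := by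
      have : r + 1 ≤ 2 * ℓ := by omega
      have : (r : ℝ) + 1 ≤ 2 * ℓ := by exact_mod_cast this
      linarith
    have hk : (0 : ℝ) < (2 * (ℓ : ℝ) - 1) ^ 2 := by
      have : (0 : ℝ) < 2 * (ℓ : ℝ) - 1 := by linarith
      positivity
    rw [← mul_div_assoc, ← add_div, div_le_iff₀ hk] at hδ
    have hsq : (r : ℝ) * r ≤ (2 * (ℓ : ℝ) - 1) ^ 2 := by
      rw [sq]
      exact mul_self_le_mul_self (Nat.cast_nonneg r) hr
    have hmul := mul_le_mul_of_nonneg_right hsq (sub_nonneg.2 hδm')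
    have : ((r * r * (m - G.minDegree) : ℕ) : ℝ) < m := by
      push_cast [hδm]
      linarith
    exact_mod_cast this
  obtain ⟨j, hj⟩ := exists_forall_adj_of_sq_mul_lt G m hm e r i₁ hlt
  have hadj : ∀ u ∈ cycWindow m e j r, ∀ w ∈ cycWindow m e i₁ r, G.Adj u w := by
    intro u hu w hw
    simp only [cycWindow, Finset.mem_image, Finset.mem_range] at hu hw
    obtain ⟨t, ht, rfl⟩ := hu
    obtain ⟨s, hs, rfl⟩ := hw
    exact hj t ht s hs
  exact ⟨j, Finset.disjoint_left.2 fun u hu hu' => G.irrefl (hadj u hu u hu'), hadj⟩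
end

section
/- Fix an integer k ≥ 2, reals α, β ∈ (0,1) with α + β ≥ 1, and a function ℓ : ℕ → ℕ with ℓ(n) ≥ 2 for all n and ℓ(n) = o(√n). Then there exists N such that for every n ≥ N, writing M = C(n,k), there is a cyclic ordering A_0, A_1, ..., A_{M−1} of all k-element subsets of [n] (indices modulo M) such that: (1) any ℓ(n) cyclically consecutive subsets A_i, A_{i+1}, ..., A_{i+ℓ(n)−1} are pairwise disjoint, hence form a (k,ℓ(n))-parpartition of [n] (a consecutive-(k,ℓ(n))-parpartition); and (2) any two consecutive-(k,ℓ(n))-parpartitions that have no k-element subset in common are not (α,β)-close. -/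
/-- Every element is related by `r` to at most `d` elements. -/
def DegreeLE {ι κ : Type*} (r : ι → κ → Prop) (d : ℕ) : Prop :=
  ∀ p, {q | r p q}.ncard ≤ d

namespace DegreeLE

variable {ι κ μ : Type*} {r : ι → κ → Prop} {d e : ℕ}

theorem comp [Finite κ] [Finite μ] {s : κ → μ → Prop} (hr : DegreeLE r d) (hs : DegreeLE s e) :
    DegreeLE (Relation.Comp r s) (d * e) := by
  classical
  have := Fintype.ofFinite κ
  have := Fintype.ofFinite μ
  intro p
  have h : {q | Relation.Comp r s p q} =
      ((({q | r p q} : Set κ).toFinset.biUnion fun m => ({q | s m q} : Set μ).toFinset :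
        Finset μ) : Set μ) := by
    ext q
    simp [Relation.Comp]
  rw [h, Set.ncard_coe_finset]
  refine (Finset.card_biUnion_le_card_mul _ _ e fun m _ => ?_).trans (Nat.mul_le_mul_right _ ?_)
  · rw [← Set.ncard_eq_toFinset_card']
    exact hs m
  · rw [← Set.ncard_eq_toFinset_card']
    exact hr p

theorem or [Finite κ] {s : ι → κ → Prop} (hr : DegreeLE r d) (hs : DegreeLE s e) :
    DegreeLE (fun p q => r p q ∨ s p q) (d + e) := fun p =>
  (Set.ncard_union_le {q | r p q} {q | s p q}).trans (Nat.add_le_add (hr p) (hs p))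

theorem onFun {r : κ → κ → Prop} (hr : DegreeLE r d) (σ : ι ≃ κ) :
    DegreeLE (Function.onFun r σ) d := fun p => by
  have h : {q | Function.onFun r σ p q} = σ ⁻¹' {q | r (σ p) q} := rfl
  rw [h, Set.ncard_preimage_of_injective_subset_range σ.injective (by simp)]
  exact hr (σ p)

theorem exists_not [Finite κ] (hr : DegreeLE r d) (hd : d < Nat.card κ) (p : ι) :
    ∃ q, ¬ r p q := by
  by_contra! h
  have h' : {q | r p q} = Set.univ := Set.eq_univ_of_forall h
  have := hr p
  rw [h', Set.ncard_univ] at this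
  omega

end DegreeLE

section Arrangement

variable {ι V : Type*}

/-- An arrangement `σ` places no two `R`-related elements at distinct `near` positions. -/
def AvoidsPairs (near : ι → ι → Prop) (R : V → V → Prop) (σ : ι ≃ V) : Prop :=
  ∀ p q, p ≠ q → near p q → ¬ R (σ p) (σ q)

/-- Two disjoint pairs of `near` positions carry crosswise `Ra`- and `Rb`-related elements. -/
def IsConflict (near : ι → ι → Prop) (Ra Rb : V → V → Prop) (σ : ι ≃ V) (p₁ q₁ p₂ q₂ : ι) :
    Prop :=
  (p₁ ≠ q₁ ∧ p₂ ≠ q₂ ∧ p₁ ≠ p₂ ∧ q₁ ≠ q₂ ∧ p₁ ≠ q₂ ∧ q₁ ≠ p₂) ∧ near p₁ q₁ ∧ near p₂ q₂ ∧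
    Ra (σ p₁) (σ p₂) ∧ Rb (σ q₁) (σ q₂)

open Relation in
/-- The positions `p` and `q` are such that exchanging `σ p` and `σ q` may create a conflict. -/
def ObstructsSwap (near : ι → ι → Prop) (R Ra Rb : V → V → Prop) (σ : ι ≃ V) (p q : ι) : Prop :=
  near p q ∨ Function.onFun R σ p q ∨
  Comp near (Function.onFun R σ) p q ∨ Comp (Function.onFun R σ) near p q ∨
  Comp near (Comp (Function.onFun Rb σ) (Comp near (Function.onFun Ra σ))) p q ∨
  Comp near (Comp (Function.onFun Ra σ) (Comp near (Function.onFun Rb σ))) p q ∨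
  Comp (Function.onFun Ra σ) (Comp near (Comp (Function.onFun Rb σ) near)) p q ∨
  Comp (Function.onFun Rb σ) (Comp near (Comp (Function.onFun Ra σ) near)) p q

variable {near : ι → ι → Prop} {R Ra Rb : V → V → Prop} {σ : ι ≃ V}

theorem ObstructsSwap.symm_roles {p q : ι} (h : ObstructsSwap near R Rb Ra σ p q) :
    ObstructsSwap near R Ra Rb σ p q := by
  unfold ObstructsSwap at h ⊢
  tauto

theorem exists_not_obstructsSwap [Finite ι] {L D Da Db : ℕ} (hnear : DegreeLE near L)
    (hR : DegreeLE R D) (hRa : DegreeLE Ra Da) (hRb : DegreeLE Rb Db)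
    (hcard : L + D + 2 * (L * D) + 4 * (L ^ 2 * (Da * Db)) < Nat.card ι) (σ : ι ≃ V) (p : ι) :
    ∃ q, ¬ ObstructsSwap near R Ra Rb σ p q := by
  have hR' := hR.onFun σ
  have ha := hRa.onFun σ
  have hb := hRb.onFun σ
  refine DegreeLE.exists_not (hnear.or <| hR'.or <| (hnear.comp hR').or <| (hR'.comp hnear).or <|
    (hnear.comp (hb.comp (hnear.comp ha))).or <| (hnear.comp (ha.comp (hnear.comp hb))).or <|
    (ha.comp (hnear.comp (hb.comp hnear))).or <| hb.comp (hnear.comp (ha.comp hnear))) ?_ p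
  calc _ = L + D + 2 * (L * D) + 4 * (L ^ 2 * (Da * Db)) := by ring
    _ < _ := hcard

theorem IsConflict.swap_pairs (hRas : Std.Symm Ra) (hRbs : Std.Symm Rb) {p₁ q₁ p₂ q₂ : ι}
    (h : IsConflict near Ra Rb σ p₁ q₁ p₂ q₂) : IsConflict near Ra Rb σ p₂ q₂ p₁ q₁ := by
  obtain ⟨⟨h₁, h₂, h₃, h₄, h₅, h₆⟩, hn, hn', ha, hb⟩ := h
  exact ⟨⟨h₂, h₁, h₃.symm, h₄.symm, h₆.symm, h₅.symm⟩, hn', hn, hRas.symm _ _ ha,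
    hRbs.symm _ _ hb⟩

theorem IsConflict.swap_roles (hsymm : Std.Symm near) {p₁ q₁ p₂ q₂ : ι}
    (h : IsConflict near Ra Rb σ p₁ q₁ p₂ q₂) : IsConflict near Rb Ra σ q₁ p₁ q₂ p₂ := by
  obtain ⟨⟨h₁, h₂, h₃, h₄, h₅, h₆⟩, hn, hn', ha, hb⟩ := h
  exact ⟨⟨h₁.symm, h₂.symm, h₄, h₃, h₆, h₅⟩, hsymm.symm _ _ hn, hsymm.symm _ _ hn', hb, ha⟩

variable [DecidableEq ι]

theorem swap_trans_apply_left (σ : ι ≃ V) (p q : ι) : (Equiv.swap p q).trans σ p = σ q := by simp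

theorem swap_trans_apply_right (σ : ι ≃ V) (p q : ι) : (Equiv.swap p q).trans σ q = σ p := by simp

theorem swap_trans_apply_of_ne (σ : ι ≃ V) {p q r : ι} (hp : r ≠ p) (hq : r ≠ q) :
    (Equiv.swap p q).trans σ r = σ r := by
  simp [Equiv.swap_apply_of_ne_of_ne hp hq]

theorem not_rel_swap_of_mem_pair (hsymm : Std.Symm near) (hRs : Std.Symm R) {p q : ι}
    (h : ¬ ObstructsSwap near R Ra Rb σ p q) {r s : ι} (hrs : r ≠ s) (hn : near r s)
    (hr : r = p ∨ r = q) :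
    ¬ R ((Equiv.swap p q).trans σ r) ((Equiv.swap p q).trans σ s) := by
  simp only [ObstructsSwap, not_or] at h
  obtain ⟨h₁, -, h₃, h₄, -⟩ := h
  intro hR
  rcases hr with rfl | rfl
  · have hsq : s ≠ q := by rintro rfl; exact h₁ hn
    rw [swap_trans_apply_left, swap_trans_apply_of_ne σ hrs.symm hsq] at hR
    exact h₃ ⟨s, hn, hRs.symm _ _ hR⟩
  · have hsp : s ≠ p := by rintro rfl; exact h₁ (hsymm.symm _ _ hn)
    rw [swap_trans_apply_right, swap_trans_apply_of_ne σ hsp hrs.symm] at hR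
    exact h₄ ⟨s, hR, hsymm.symm _ _ hn⟩

theorem exists_avoidsPairs [Finite ι] (hsymm : Std.Symm near) (hRs : Std.Symm R)
    (hswap : ∀ (σ : ι ≃ V) (p : ι), ∃ q, ¬ ObstructsSwap near R Ra Rb σ p q) (σ₀ : ι ≃ V) :
    ∃ σ : ι ≃ V, AvoidsPairs near R σ := by
  let bad : (ι ≃ V) → Set (ι × ι) := fun σ =>
    {t | t.1 ≠ t.2 ∧ near t.1 t.2 ∧ R (σ t.1) (σ t.2)}
  suffices H : ∀ (m : ℕ) (σ : ι ≃ V), (bad σ).ncard = m → ∃ σ : ι ≃ V, AvoidsPairs near R σ from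
    H _ σ₀ rfl
  intro m
  induction m using Nat.strong_induction_on with
  | _ m ih =>
  intro σ hm
  by_cases hσ : AvoidsPairs near R σ
  · exact ⟨σ, hσ⟩
  simp only [AvoidsPairs, not_forall, not_not] at hσ
  obtain ⟨p, p', hpp, hn, hR⟩ := hσ
  obtain ⟨q, hq⟩ := hswap σ p
  refine ih _ (hm ▸ ?_) ((Equiv.swap p q).trans σ) rfl
  refine Set.ncard_lt_ncard ⟨?_, fun hsub => ?_⟩ (Set.toFinite _)
  · rintro ⟨r, s⟩ ⟨hrs, hnrs, hRrs⟩
    have hr : ¬ (r = p ∨ r = q) := fun hr => not_rel_swap_of_mem_pair hsymm hRs hq hrs hnrs hr hRrs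
    have hs : ¬ (s = p ∨ s = q) := fun hs =>
      not_rel_swap_of_mem_pair hsymm hRs hq hrs.symm (hsymm.symm _ _ hnrs) hs (hRs.symm _ _ hRrs)
    simp only [not_or] at hr hs
    refine ⟨hrs, hnrs, ?_⟩
    rwa [swap_trans_apply_of_ne σ hr.1 hr.2, swap_trans_apply_of_ne σ hs.1 hs.2] at hRrs
  · have hmem : (p, p') ∈ bad σ := ⟨hpp, hn, hR⟩
    exact not_rel_swap_of_mem_pair hsymm hRs hq hpp hn (.inl rfl) (hsub hmem).2.2

theorem AvoidsPairs.swap (hsymm : Std.Symm near) (hRs : Std.Symm R) {p q : ι}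
    (hσ : AvoidsPairs near R σ) (h : ¬ ObstructsSwap near R Ra Rb σ p q) :
    AvoidsPairs near R ((Equiv.swap p q).trans σ) := by
  intro r s hrs hn hR
  by_cases hr : r = p ∨ r = q
  · exact not_rel_swap_of_mem_pair hsymm hRs h hrs hn hr hR
  by_cases hs : s = p ∨ s = q
  · exact not_rel_swap_of_mem_pair hsymm hRs h hrs.symm (hsymm.symm _ _ hn) hs (hRs.symm _ _ hR)
  simp only [not_or] at hr hs
  rw [swap_trans_apply_of_ne σ hr.1 hr.2, swap_trans_apply_of_ne σ hs.1 hs.2] at hR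
  exact hσ r s hrs hn hR

theorem not_isConflict_swap_of_mem_pair (hsymm : Std.Symm near) (hRs : Std.Symm R)
    (hRas : Std.Symm Ra) (hRbs : Std.Symm Rb) (haR : ∀ x y, Ra x y → R x y)
    (hbR : ∀ x y, Rb x y → R x y) {p q : ι} (hσ : AvoidsPairs near R σ)
    (h : ¬ ObstructsSwap near R Ra Rb σ p q) {p₁ q₁ p₂ q₂ : ι} (hp₁ : p₁ = p ∨ p₁ = q) :
    ¬ IsConflict near Ra Rb ((Equiv.swap p q).trans σ) p₁ q₁ p₂ q₂ := by
  simp only [ObstructsSwap, not_or] at h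
  obtain ⟨h₁, h₂, -, -, h₅, -, h₇, -⟩ := h
  rintro ⟨⟨hpq₁, -, hpp, -, hpq, -⟩, hn, hn', ha, hb⟩
  rcases hp₁ with rfl | rfl
  · have hq₁ : q₁ ≠ q := by rintro rfl; exact h₁ hn
    rw [swap_trans_apply_left] at ha
    rw [swap_trans_apply_of_ne σ hpq₁.symm hq₁] at hb
    by_cases hp₂ : p₂ = q
    · rw [hp₂, swap_trans_apply_right] at ha
      exact h₂ (hRs.symm _ _ (haR _ _ ha))
    by_cases hq₂ : q₂ = q
    · rw [hq₂, swap_trans_apply_right] at hb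
      exact hσ _ _ hpq₁ hn (hRs.symm _ _ (hbR _ _ hb))
    rw [swap_trans_apply_of_ne σ hpp.symm hp₂] at ha
    rw [swap_trans_apply_of_ne σ hpq.symm hq₂] at hb
    exact h₅ ⟨q₁, hn, q₂, hb, p₂, hsymm.symm _ _ hn', hRas.symm _ _ ha⟩
  · have hq₁ : q₁ ≠ p := by rintro rfl; exact h₁ (hsymm.symm _ _ hn)
    rw [swap_trans_apply_right] at ha
    rw [swap_trans_apply_of_ne σ hq₁ hpq₁.symm] at hb
    by_cases hp₂ : p₂ = p
    · rw [hp₂, swap_trans_apply_left] at ha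
      exact h₂ (haR _ _ ha)
    by_cases hq₂ : q₂ = p
    · rw [hq₂, swap_trans_apply_left] at hb
      exact hσ _ _ hpq₁ hn (hRs.symm _ _ (hbR _ _ hb))
    rw [swap_trans_apply_of_ne σ hp₂ hpp.symm] at ha
    rw [swap_trans_apply_of_ne σ hq₂ hpq.symm] at hb
    exact h₇ ⟨p₂, ha, q₂, hn', q₁, hRbs.symm _ _ hb, hsymm.symm _ _ hn⟩

theorem exists_avoidsPairs_forall_not_isConflict [Finite ι] (hsymm : Std.Symm near)
    (hRs : Std.Symm R) (hRas : Std.Symm Ra) (hRbs : Std.Symm Rb) (haR : ∀ x y, Ra x y → R x y)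
    (hbR : ∀ x y, Rb x y → R x y)
    (hswap : ∀ (σ : ι ≃ V) (p : ι), ∃ q, ¬ ObstructsSwap near R Ra Rb σ p q) (σ₀ : ι ≃ V) :
    ∃ σ : ι ≃ V, AvoidsPairs near R σ ∧ ∀ p₁ q₁ p₂ q₂, ¬ IsConflict near Ra Rb σ p₁ q₁ p₂ q₂ := by
  obtain ⟨σ₁, hσ₁⟩ := exists_avoidsPairs hsymm hRs hswap σ₀
  let bad : (ι ≃ V) → Set (ι × ι × ι × ι) := fun σ =>
    {t | IsConflict near Ra Rb σ t.1 t.2.1 t.2.2.1 t.2.2.2}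
  suffices H : ∀ (m : ℕ) (σ : ι ≃ V), AvoidsPairs near R σ → (bad σ).ncard = m →
      ∃ σ : ι ≃ V, AvoidsPairs near R σ ∧
        ∀ p₁ q₁ p₂ q₂, ¬ IsConflict near Ra Rb σ p₁ q₁ p₂ q₂ from H _ σ₁ hσ₁ rfl
  intro m
  induction m using Nat.strong_induction_on with
  | _ m ih =>
  intro σ hσ hm
  by_cases hc : ∀ p₁ q₁ p₂ q₂, ¬ IsConflict near Ra Rb σ p₁ q₁ p₂ q₂
  · exact ⟨σ, hσ, hc⟩
  push Not at hc
  obtain ⟨p, q', p', q'', hc⟩ := hc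
  obtain ⟨q, hq⟩ := hswap σ p
  refine ih _ (hm ▸ ?_) _ (hσ.swap hsymm hRs hq) rfl
  refine Set.ncard_lt_ncard ⟨?_, fun hsub => ?_⟩ (Set.toFinite _)
  · rintro ⟨p₁, q₁, p₂, q₂⟩ ht
    replace ht : IsConflict near Ra Rb ((Equiv.swap p q).trans σ) p₁ q₁ p₂ q₂ := ht
    have hq' : ¬ ObstructsSwap near R Rb Ra σ p q := fun h => hq h.symm_roles
    have k₁ := fun h => not_isConflict_swap_of_mem_pair hsymm hRs hRas hRbs haR hbR hσ hq h ht
    have k₂ := fun h => not_isConflict_swap_of_mem_pair hsymm hRs hRas hRbs haR hbR hσ hq h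
      (ht.swap_pairs hRas hRbs)
    have k₃ := fun h => not_isConflict_swap_of_mem_pair hsymm hRs hRbs hRas hbR haR hσ hq' h
      (ht.swap_roles hsymm)
    have k₄ := fun h => not_isConflict_swap_of_mem_pair hsymm hRs hRbs hRas hbR haR hσ hq' h
      ((ht.swap_pairs hRas hRbs).swap_roles hsymm)
    simp only [imp_false, not_or] at k₁ k₂ k₃ k₄
    obtain ⟨hne, hn, hn', ha, hb⟩ := ht
    rw [swap_trans_apply_of_ne σ k₁.1 k₁.2, swap_trans_apply_of_ne σ k₂.1 k₂.2] at ha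
    rw [swap_trans_apply_of_ne σ k₃.1 k₃.2, swap_trans_apply_of_ne σ k₄.1 k₄.2] at hb
    exact ⟨hne, hn, hn', ha, hb⟩
  · have hmem : (p, q', p', q'') ∈ bad σ := hc
    exact not_isConflict_swap_of_mem_pair hsymm hRs hRas hRbs haR hbR hσ hq (.inl rfl) (hsub hmem)

end Arrangement

open Finset in
theorem card_filter_le_card_inter (X S : Finset ℕ) (k a : ℕ) (hS : S.card = k) :
    #{T ∈ powersetCard k X | a ≤ #(S ∩ T)} ≤ 2 ^ k * #X ^ (k - a) := by
  classical
  have hsub : {T ∈ powersetCard k X | a ≤ #(S ∩ T)} ⊆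
      (powersetCard a S ×ˢ powersetCard (k - a) X).image fun t => t.1 ∪ t.2 := by
    intro T hT
    simp only [mem_filter, mem_powersetCard] at hT
    obtain ⟨⟨hTX, hTk⟩, ha⟩ := hT
    obtain ⟨U, hU, hUa⟩ := exists_subset_card_eq ha
    have hUT : U ⊆ T := hU.trans inter_subset_right
    simp only [mem_image, mem_product, mem_powersetCard, Prod.exists]
    exact ⟨U, T \ U, ⟨⟨hU.trans inter_subset_left, hUa⟩, sdiff_subset.trans hTX,
      by rw [card_sdiff_of_subset hUT, hTk, hUa]⟩, union_sdiff_of_subset hUT⟩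
  calc _ ≤ _ := card_le_card hsub
    _ ≤ _ := card_image_le
    _ = k.choose a * (#X).choose (k - a) := by simp [hS]
    _ ≤ _ := Nat.mul_le_mul (Nat.choose_le_two_pow k a) (Nat.choose_le_pow _ _)

theorem degreeLE_card_inter (X : Finset ℕ) (k a : ℕ) :
    DegreeLE (fun S T : Finset.powersetCard k X => a ≤ ((S : Finset ℕ) ∩ T).card)
      (2 ^ k * X.card ^ (k - a)) := by
  intro S
  refine le_trans ?_ (card_filter_le_card_inter X S k a (Finset.mem_powersetCard.1 S.2).2)
  rw [← Set.ncard_image_of_injective _ Subtype.val_injective, ← Set.ncard_coe_finset]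
  refine Set.ncard_le_ncard ?_ (Finset.finite_toSet _)
  rintro _ ⟨T, hT, rfl⟩
  exact Finset.mem_coe.2 (Finset.mem_filter.2 ⟨T.2, hT⟩)

/-- Two elements of an additive group are reached from one another by fewer than `l` unit steps. -/
def NearBy (l : ℕ) {G : Type*} [AddGroupWithOne G] (p q : G) : Prop :=
  (∃ s < l, q = p + (s : G)) ∨ ∃ s < l, q = p - (s : G)

theorem NearBy.symm_rel (l : ℕ) {G : Type*} [AddGroupWithOne G] :
    Std.Symm (NearBy l (G := G)) := by
  refine ⟨fun p q h => ?_⟩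
  rcases h with ⟨s, hs, rfl⟩ | ⟨s, hs, rfl⟩
  · exact .inr ⟨s, hs, by simp⟩
  · exact .inl ⟨s, hs, by simp⟩

theorem nearBy_add_natCast {l s t : ℕ} {G : Type*} [AddGroupWithOne G] (i : G) (hs : s < l)
    (ht : t < l) : NearBy l (i + (s : G)) (i + (t : G)) := by
  rcases le_total s t with h | h
  · exact .inl ⟨t - s, by omega, by rw [add_assoc, ← Nat.cast_add, Nat.add_sub_cancel' h]⟩
  · refine .inr ⟨s - t, by omega, ?_⟩
    rw [eq_sub_iff_add_eq, add_assoc, ← Nat.cast_add, Nat.add_sub_cancel' h]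

theorem degreeLE_nearBy (l : ℕ) {G : Type*} [AddGroupWithOne G] :
    DegreeLE (NearBy l (G := G)) (2 * l) := by
  classical
  intro p
  have h : {q | NearBy l p q} = (((Finset.range l).image fun s : ℕ => p + (s : G)) ∪
      (Finset.range l).image fun s : ℕ => p - (s : G) : Finset G) := by
    ext q
    simp [NearBy, eq_comm]
  rw [h, Set.ncard_coe_finset, two_mul]
  refine (Finset.card_union_le _ _).trans (Nat.add_le_add ?_ ?_) <;>
    exact Finset.card_image_le.trans (Finset.card_range l).le

theorem count_lt_choose {k n l a b : ℕ} (hk : 1 ≤ k) (hn : 2 * k ≤ n) (hl : 1 ≤ l) (ha : a ≤ k)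
    (hb : b ≤ k) (hab : k + 1 ≤ a + b) (h : 23 * 8 ^ k * k.factorial * l ^ 2 < n) :
    2 * l + 2 ^ k * n ^ (k - 1) + 2 * (2 * l * (2 ^ k * n ^ (k - 1))) +
      4 * ((2 * l) ^ 2 * (2 ^ k * n ^ (k - a) * (2 ^ k * n ^ (k - b)))) < n.choose k := by
  have hn1 : 1 ≤ n := by omega
  set P := n ^ (k - 1) with hP
  have hP1 : 1 ≤ P := Nat.one_le_pow _ _ hn1
  have hll : l ≤ l ^ 2 := Nat.le_self_pow two_ne_zero l
  have h4 : 2 ^ k * 2 ^ k = 4 ^ k := by rw [← mul_pow]; norm_num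
  have h24 : 2 ^ k ≤ 4 ^ k := Nat.pow_le_pow_left (by norm_num) k
  have h41 : 1 ≤ 4 ^ k := Nat.one_le_pow _ _ (by norm_num)
  have hab' : n ^ (k - a) * n ^ (k - b) ≤ P := by
    rw [← pow_add]
    exact Nat.pow_le_pow_right hn1 (by omega)
  have hQ : 1 ≤ l ^ 2 := hl.trans hll
  have e₁ : 2 * l ≤ 2 * (4 ^ k * l ^ 2 * P) := by
    have : l * 1 ≤ 4 ^ k * l ^ 2 * P := Nat.mul_le_mul (by nlinarith) hP1
    omega
  have e₂ : 2 ^ k * P ≤ 4 ^ k * l ^ 2 * P := Nat.mul_le_mul_right _ (by nlinarith)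
  have e₃ : 2 * (2 * l * (2 ^ k * P)) ≤ 4 * (4 ^ k * l ^ 2 * P) := by
    have : 2 ^ k * l * P ≤ 4 ^ k * l ^ 2 * P := by gcongr
    linarith
  have e₄ : 4 * ((2 * l) ^ 2 * (2 ^ k * n ^ (k - a) * (2 ^ k * n ^ (k - b)))) ≤
      16 * (4 ^ k * l ^ 2 * P) := by
    calc _ = 16 * ((2 ^ k * 2 ^ k) * l ^ 2 * (n ^ (k - a) * n ^ (k - b))) := by ring
      _ ≤ _ := by rw [h4]; gcongr
  have hpow : n ^ k ≤ 2 ^ k * k.factorial * n.choose k := by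
    calc n ^ k ≤ (2 * (n + 1 - k)) ^ k := Nat.pow_le_pow_left (by omega) k
      _ = 2 ^ k * (n + 1 - k) ^ k := mul_pow _ _ _
      _ ≤ 2 ^ k * n.descFactorial k := Nat.mul_le_mul_left _ (Nat.pow_sub_le_descFactorial n k)
      _ = _ := by rw [Nat.descFactorial_eq_factorial_mul_choose, mul_assoc]
  have h8 : 2 ^ k * 4 ^ k = 8 ^ k := by rw [← mul_pow]; norm_num
  have hlt : 2 ^ k * k.factorial * (23 * (4 ^ k * l ^ 2 * P)) <
      2 ^ k * k.factorial * n.choose k := by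
    calc _ = 23 * (2 ^ k * 4 ^ k) * k.factorial * l ^ 2 * P := by ring
      _ = 23 * 8 ^ k * k.factorial * l ^ 2 * P := by rw [h8]
      _ < n * P := Nat.mul_lt_mul_of_pos_right h hP1
      _ = n ^ k := by rw [hP, ← pow_succ', Nat.sub_add_cancel hk]
      _ ≤ _ := hpow
  have := Nat.lt_of_mul_lt_mul_left hlt
  omega

theorem eventually_mul_sq_lt_of_isLittleO_sqrt {ℓ : ℕ → ℕ}
    (hℓ : (fun n : ℕ => (ℓ n : ℝ)) =o[Filter.atTop] fun n : ℕ => Real.sqrt n) (K : ℕ) :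
    ∀ᶠ n in Filter.atTop, K * ℓ n ^ 2 < n := by
  have hc : (0 : ℝ) < 1 / (K + 1) := by positivity
  filter_upwards [hℓ.def hc, Filter.eventually_gt_atTop 0] with n hn hpos
  rw [Real.norm_natCast, Real.norm_of_nonneg (Real.sqrt_nonneg _)] at hn
  have hn' : ((K : ℝ) + 1) * ℓ n ≤ Real.sqrt n := by
    rwa [one_div, ← div_eq_inv_mul, le_div_iff₀' (by positivity)] at hn
  have hsq : (((K : ℝ) + 1) * ℓ n) ^ 2 ≤ n :=
    (pow_le_pow_left₀ (by positivity) hn' 2).trans_eq (Real.sq_sqrt n.cast_nonneg)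
  have hsq' : ((K + 1) * ℓ n) ^ 2 ≤ n := by exact_mod_cast hsq
  rcases Nat.eq_zero_or_pos (ℓ n) with h0 | h0
  · simpa [h0] using hpos
  · have : 0 < ℓ n ^ 2 := by positivity
    nlinarith

theorem floor_add_one_le_of_mul_lt {α : ℝ} {k c : ℕ} (hα : 0 ≤ α) (h : α * k < c) :
    ⌊α * k⌋₊ + 1 ≤ c :=
  Nat.succ_le_of_lt ((Nat.floor_lt (by positivity)).2 h)

theorem stmt10 (k : ℕ) (hk : 2 ≤ k) (α β : ℝ) (hα : α ∈ Set.Ioo (0 : ℝ) 1)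
    (hβ : β ∈ Set.Ioo (0 : ℝ) 1) (hαβ : 1 ≤ α + β)
    (ℓ : ℕ → ℕ) (hℓ2 : ∀ n, 2 ≤ ℓ n)
    (hℓo : (fun n : ℕ => (ℓ n : ℝ)) =o[Filter.atTop] fun n : ℕ => Real.sqrt n) :
    ∃ N : ℕ, ∀ n : ℕ, N ≤ n →
      ∃ A : ZMod (n.choose k) → Finset ℕ,
        Function.Injective A ∧
        (∀ i, A i ⊆ Finset.Icc 1 n ∧ (A i).card = k) ∧
        (∀ S : Finset ℕ, S ⊆ Finset.Icc 1 n → S.card = k → ∃ i, A i = S) ∧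
        (∀ i : ZMod (n.choose k), ∀ s t : ℕ, s < ℓ n → t < ℓ n → s ≠ t →
          Disjoint (A (i + (s : ZMod (n.choose k)))) (A (i + (t : ZMod (n.choose k))))) ∧
        (∀ i j : ZMod (n.choose k),
          Disjoint
            ((Finset.range (ℓ n)).image fun t : ℕ => A (i + (t : ZMod (n.choose k))))
            ((Finset.range (ℓ n)).image fun t : ℕ => A (j + (t : ZMod (n.choose k)))) →
          ¬ ABClose α β k
            ((Finset.range (ℓ n)).image fun t : ℕ => A (i + (t : ZMod (n.choose k))))
            ((Finset.range (ℓ n)).image fun t : ℕ => A (j + (t : ZMod (n.choose k))))) := by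
  obtain ⟨N, hN⟩ := Filter.eventually_atTop.1
    ((eventually_mul_sq_lt_of_isLittleO_sqrt hℓo (23 * 8 ^ k * k.factorial)).and
      (Filter.eventually_ge_atTop (2 * k)))
  refine ⟨N, fun n hn => ?_⟩
  obtain ⟨hbig, hkn⟩ := hN n hn
  set a := ⌊α * k⌋₊ + 1 with ha
  set b := ⌊β * k⌋₊ + 1 with hb
  have hk0 : (0 : ℝ) < k := by exact_mod_cast (by omega : 0 < k)
  have hak : a ≤ k := floor_add_one_le_of_mul_lt hα.1.le (by nlinarith [hα.2])
  have hbk : b ≤ k := floor_add_one_le_of_mul_lt hβ.1.le (by nlinarith [hβ.2])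
  have hab : k + 1 ≤ a + b := by
    have h₁ : α * k < a := by rw [ha]; exact_mod_cast Nat.lt_floor_add_one (α * k)
    have h₂ : β * k < b := by rw [hb]; exact_mod_cast Nat.lt_floor_add_one (β * k)
    have : (k : ℝ) < ((a + b : ℕ) : ℝ) := by push_cast; nlinarith
    exact_mod_cast this
  have hcount := count_lt_choose (by omega : 1 ≤ k) hkn (by have := hℓ2 n; omega : 1 ≤ ℓ n)
    hak hbk hab hbig
  have hℓM : ℓ n ≤ n.choose k := by omega
  have : NeZero (n.choose k) := ⟨by omega⟩
  let X := Finset.Icc 1 n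
  let V := Finset.powersetCard k X
  let rel : ℕ → V → V → Prop := fun c S T => c ≤ ((S : Finset ℕ) ∩ T).card
  have hX : X.card = n := by simp [X]
  have hdeg : ∀ c, DegreeLE (rel c) (2 ^ k * n ^ (k - c)) := fun c => by
    have := degreeLE_card_inter X k c
    rwa [hX] at this
  have hrel : ∀ c, Std.Symm (rel c) := fun c => ⟨fun S T h => by
    simpa only [rel, Finset.inter_comm] using h⟩
  have hcard : Fintype.card (ZMod (n.choose k)) = Fintype.card V := by
    rw [ZMod.card, Fintype.card_coe, Finset.card_powersetCard, hX]
  obtain ⟨σ, hσ, hconf⟩ := exists_avoidsPairs_forall_not_isConflict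
    (NearBy.symm_rel (ℓ n)) (hrel 1) (hrel a) (hrel b)
    (fun S T h => le_trans (by omega) h) (fun S T h => le_trans (by omega) h)
    (exists_not_obstructsSwap (degreeLE_nearBy (ℓ n)) (hdeg 1) (hdeg a) (hdeg b)
      (by rwa [Nat.card_eq_fintype_card, ZMod.card]))
    (Fintype.equivOfCardEq hcard)
  have hV : ∀ i, (σ i : Finset ℕ) ⊆ X ∧ (σ i : Finset ℕ).card = k := fun i =>
    Finset.mem_powersetCard.1 (σ i).2
  refine ⟨fun i => σ i, Subtype.val_injective.comp σ.injective, hV, fun S hS hSk => ?_,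
    fun i s t hs ht hst => ?_, fun i j hij hclose => ?_⟩
  · exact ⟨σ.symm ⟨S, Finset.mem_powersetCard.2 ⟨hS, hSk⟩⟩, by simp⟩
  · have hne : i + (s : ZMod (n.choose k)) ≠ i + (t : ZMod (n.choose k)) := by
      intro h
      have := (ZMod.natCast_eq_natCast_iff' _ _ _).1 (add_left_cancel h)
      rw [Nat.mod_eq_of_lt (hs.trans_le hℓM), Nat.mod_eq_of_lt (ht.trans_le hℓM)] at this
      exact hst this
    have := hσ _ _ hne (nearBy_add_natCast i hs ht)
    rw [Finset.disjoint_iff_inter_eq_empty, ← Finset.card_eq_zero]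
    exact Nat.lt_one_iff.1 (not_le.1 this)
  · obtain ⟨A₁, hA₁, B₁, hB₁, A₂, hA₂, B₂, hB₂, hAB₁, hAB₂, hα', hβ'⟩ := hclose
    simp only [Finset.mem_image, Finset.mem_range] at hA₁ hB₁ hA₂ hB₂
    obtain ⟨s₁, hs₁, rfl⟩ := hA₁
    obtain ⟨t₁, ht₁, rfl⟩ := hB₁
    obtain ⟨s₂, hs₂, rfl⟩ := hA₂
    obtain ⟨t₂, ht₂, rfl⟩ := hB₂
    have ne : ∀ s < ℓ n, ∀ t < ℓ n, i + (s : ZMod (n.choose k)) ≠ j + (t : ZMod (n.choose k)) := by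
      intro s hs t ht h
      exact Finset.disjoint_left.1 hij (Finset.mem_image_of_mem _ (Finset.mem_range.2 hs))
        (h ▸ Finset.mem_image_of_mem _ (Finset.mem_range.2 ht))
    refine hconf _ _ _ _ ⟨⟨fun h => hAB₁ (by rw [h]), fun h => hAB₂ (by rw [h]), ne _ hs₁ _ hs₂,
      ne _ ht₁ _ ht₂, ne _ hs₁ _ ht₂, ne _ ht₁ _ hs₂⟩, nearBy_add_natCast i hs₁ ht₁,
      nearBy_add_natCast j hs₂ ht₂, floor_add_one_le_of_mul_lt hα.1.le hα',
      floor_add_one_le_of_mul_lt hβ.1.le hβ'⟩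
end

section
/- Fix an integer k ≥ 2 and reals α, β ∈ (0,1) with α + β ≥ (k+2)/k. Then there exists N such that for every integer n ≥ N and every integer ℓ ≥ 2 with 3k²ℓ ≤ n, one has (Σ_{1 ≤ i < (1−α)k} C(k,i)·C(n−k,i)) · (Σ_{1 ≤ i < (1−β)k} C(k,i)·C(n−k,i)) ≤ (C(n,k) − 3)/(15ℓ²), where each sum ranges over integers i with 1 ≤ i < (1−α)k (respectively 1 ≤ i < (1−β)k). -/
theorem choose_mul_choose_le (k n i j m : ℕ) (hn : 1 ≤ n) (hij : i + j ≤ m) :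
    (k.choose i * (n - k).choose i) * (k.choose j * (n - k).choose j) ≤ 4 ^ k * n ^ m := by
  have h (t : ℕ) : (n - k).choose t ≤ n ^ t :=
    (Nat.choose_le_pow (n - k) t).trans (Nat.pow_le_pow_left (Nat.sub_le n k) t)
  calc (k.choose i * (n - k).choose i) * (k.choose j * (n - k).choose j)
      ≤ (2 ^ k * n ^ i) * (2 ^ k * n ^ j) := by
        gcongr
        · exact Nat.choose_le_two_pow k i
        · exact h i
        · exact Nat.choose_le_two_pow k j
        · exact h j
    _ = 4 ^ k * n ^ (i + j) := by
        rw [show 4 = 2 * 2 from rfl, mul_pow, pow_add, mul_mul_mul_comm]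
    _ ≤ 4 ^ k * n ^ m := by gcongr

open Classical in
theorem sum_mul_sum_le (k n m : ℕ) (hn : 1 ≤ n) (x y : ℝ) (hxy : x + y ≤ m + 1) :
    (∑ i ∈ Finset.Ico 1 (k + 1),
        if (i : ℝ) < x then (k.choose i * (n - k).choose i : ℝ) else 0) *
      (∑ i ∈ Finset.Ico 1 (k + 1),
        if (i : ℝ) < y then (k.choose i * (n - k).choose i : ℝ) else 0) ≤
      k ^ 2 * 4 ^ k * (n : ℝ) ^ m := by
  rw [Finset.sum_mul_sum]
  have h : ∀ i ∈ Finset.Ico 1 (k + 1), ∀ j ∈ Finset.Ico 1 (k + 1),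
      (if (i : ℝ) < x then (k.choose i * (n - k).choose i : ℝ) else 0) *
        (if (j : ℝ) < y then (k.choose j * (n - k).choose j : ℝ) else 0) ≤
      4 ^ k * (n : ℝ) ^ m := by
    intro i _ j _
    split_ifs with hi hj
    · have hij : i + j < m + 1 := by
        have : (i : ℝ) + j < m + 1 := by linarith
        exact_mod_cast this
      exact_mod_cast choose_mul_choose_le k n i j m hn (by omega)
    all_goals simp only [mul_zero, zero_mul]; positivity
  refine (Finset.sum_le_sum fun i hi => Finset.sum_le_sum (h i hi)).trans_eq ?_
  simp only [Finset.sum_const, Nat.card_Ico, add_tsub_cancel_right, nsmul_eq_mul]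
  ring

theorem pow_le_two_pow_mul_factorial_mul_choose (k n : ℕ) (h : 2 * k ≤ n) :
    n ^ k ≤ 2 ^ k * k.factorial * n.choose k := by
  have h1 : (n + 1 - k) ^ k ≤ k.factorial * n.choose k := by
    have h2 := Nat.pow_le_choose (α := ℚ) k n
    rw [div_le_iff₀' (by positivity)] at h2
    exact_mod_cast h2
  calc n ^ k ≤ (2 * (n + 1 - k)) ^ k := Nat.pow_le_pow_left (by omega) k
    _ = 2 ^ k * (n + 1 - k) ^ k := mul_pow ..
    _ ≤ 2 ^ k * (k.factorial * n.choose k) := by gcongr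
    _ = _ := by ring

theorem mul_pow_add_three_le_choose (c k n : ℕ) (hk : 1 ≤ k)
    (h : 2 ^ k * k.factorial * (c + 3) + 2 * k ≤ n) :
    c * n ^ (k - 1) + 3 ≤ n.choose k := by
  have hpos : 0 < 2 ^ k * k.factorial := by positivity
  have hp : 1 ≤ n ^ (k - 1) := Nat.one_le_pow _ _ (by omega)
  refine Nat.le_of_mul_le_mul_left ?_ hpos
  calc 2 ^ k * k.factorial * (c * n ^ (k - 1) + 3)
      ≤ 2 ^ k * k.factorial * (c * n ^ (k - 1) + 3 * n ^ (k - 1)) := by gcongr; omega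
    _ = 2 ^ k * k.factorial * (c + 3) * n ^ (k - 1) := by ring
    _ ≤ n * n ^ (k - 1) := by gcongr; omega
    _ = n ^ k := by rw [← pow_succ', Nat.sub_add_cancel hk]
    _ ≤ _ := pow_le_two_pow_mul_factorial_mul_choose k n (by omega)


open Classical in
theorem stmt14 (k : ℕ) (hk : 2 ≤ k) (α β : ℝ) (hα : α ∈ Set.Ioo (0 : ℝ) 1)
    (hβ : β ∈ Set.Ioo (0 : ℝ) 1) (hαβ : ((k : ℝ) + 2) / k ≤ α + β) :
    ∃ N : ℕ, ∀ n : ℕ, N ≤ n → ∀ ℓ : ℕ, 2 ≤ ℓ → 3 * k ^ 2 * ℓ ≤ n →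
      (∑ i ∈ Finset.Ico 1 (k + 1),
          if (i : ℝ) < (1 - α) * k then (k.choose i * (n - k).choose i : ℝ) else 0) *
        (∑ i ∈ Finset.Ico 1 (k + 1),
          if (i : ℝ) < (1 - β) * k then (k.choose i * (n - k).choose i : ℝ) else 0) ≤
        ((n.choose k : ℝ) - 3) / (15 * (ℓ : ℝ) ^ 2) := by
  have hk0 : (0 : ℝ) < k := by positivity
  rw [div_le_iff₀ hk0] at hαβ
  have hk3 : 3 ≤ k := by
    have : (2 : ℝ) < k := by nlinarith [hα.2, hβ.2]
    exact_mod_cast this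
  obtain ⟨m, rfl⟩ := Nat.exists_eq_add_of_le' hk3
  refine ⟨2 ^ (m + 3) * (m + 3).factorial * (15 * ((m + 3) ^ 2 * 4 ^ (m + 3)) + 3) + 2 * (m + 3),
    fun n hn ℓ hℓ hℓn => ?_⟩
  have hℓle : ℓ ≤ n := (Nat.le_mul_of_pos_left ℓ (by positivity)).trans hℓn
  have hchoose : 15 * (((m + 3 : ℕ) : ℝ) ^ 2 * 4 ^ (m + 3)) * (n : ℝ) ^ (m + 2) + 3 ≤
      n.choose (m + 3) := by
    exact_mod_cast mul_pow_add_three_le_choose _ (m + 3) n (by omega) hn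
  have hℓ0 : (0 : ℝ) < ℓ := by exact_mod_cast (by omega : 0 < ℓ)
  rw [le_div_iff₀ (by positivity)]
  have hsum := sum_mul_sum_le (m + 3) n m (by omega) ((1 - α) * (m + 3 : ℕ))
    ((1 - β) * (m + 3 : ℕ)) (by push_cast at hαβ ⊢; linarith)
  calc _ ≤ ((m + 3 : ℕ) : ℝ) ^ 2 * 4 ^ (m + 3) * (n : ℝ) ^ m * (15 * (ℓ : ℝ) ^ 2) := by gcongr
    _ ≤ ((m + 3 : ℕ) : ℝ) ^ 2 * 4 ^ (m + 3) * (n : ℝ) ^ m * (15 * (n : ℝ) ^ 2) := by gcongr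
    _ = 15 * (((m + 3 : ℕ) : ℝ) ^ 2 * 4 ^ (m + 3)) * (n : ℝ) ^ (m + 2) := by ring
    _ ≤ _ := by linarith
end
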